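/- For Hamiltonian paths on SG(n) (n ≥ 2) with one end at o, the distribution ratio at the mid-side vertices is as follows. At level m = n−1: F(n,a_{n-1,2}) = F(n,c_{n-1,2}) = F(n,b_{n-1,1}) = F(n,c_{n-1,1}) = 1/2 if n > 2 and = 5/12 if n = 2; F(n,b_{n-1,2}) = F(n,a_{n-1,1}) = 0 if n > 2 and = 1/6 if n = 2. At levels 1 ≤ m ≤ n−2: F(n,a_{m,2}) = F(n,b_{m,1}) = 1/2 if m > 1 and = 11/18 if m = 1; F(n,b_{m,2}) = F(n,a_{m,1}) = 1 if m > 1 and = 49/72 if m = 1; F(n,c_{m,2}) = F(n,c_{m,1}) = 3/2 if m > 1 and = 73/72 if m = 1. -/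

import Mathlib

open scoped Classical
open Filter Topology

noncomputable section

namespace SierpinskiGasket

/-- √3 -/
def sq3 : ℝ := Real.sqrt 3

/-- the origin, leftmost outmost vertex of every `SG n` -/
def o : ℝ × ℝ := (0, 0)

/-- `a m = (2^m, 0)`, the rightmost vertex of `SG m` (also a translation vector). -/
def a (m : ℕ) : ℝ × ℝ := ((2:ℝ) ^ m, 0)

/-- `b m = (2^(m-1), 2^(m-1)·√3)`, the topmost vertex of `SG m`. -/
def b (m : ℕ) : ℝ × ℝ := ((2:ℝ) ^ m / 2, (2:ℝ) ^ m / 2 * sq3)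

/-- `c m = (3·2^(m-1), 2^(m-1)·√3)`. -/
def c (m : ℕ) : ℝ × ℝ := (3 * (2:ℝ) ^ m / 2, (2:ℝ) ^ m / 2 * sq3)

/-- vertex set of `SG n` -/
def V : ℕ → Set (ℝ × ℝ)
  | 0 => {o, a 0, b 0}
  | n + 1 => V n ∪ ((· + a n) '' V n) ∪ ((· + b n) '' V n)

/-- edge set of `SG n` -/
def E : ℕ → Set (Sym2 (ℝ × ℝ))
  | 0 => {s(o, a 0), s(o, b 0), s(a 0, b 0)}
  | n + 1 => E n ∪ (Sym2.map (· + a n) '' E n) ∪ (Sym2.map (· + b n) '' E n)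

/-- `SG n` as a simple graph on `ℝ × ℝ` -/
def G (n : ℕ) : SimpleGraph (ℝ × ℝ) := SimpleGraph.fromEdgeSet (E n)

/-- a Hamiltonian path of `SG n`: a path visiting every vertex of `SG n` exactly once -/
def IsHamPath (n : ℕ) {u v : ℝ × ℝ} (p : (G n).Walk u v) : Prop :=
  p.IsPath ∧ ∀ x, x ∈ p.support ↔ x ∈ V n

/-- a Hamiltonian cycle of `SG n` -/
def IsHamCycle (n : ℕ) {u : ℝ × ℝ} (p : (G n).Walk u u) : Prop :=
  p.IsCycle ∧ ∀ x, x ∈ p.support ↔ x ∈ V n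

/-- `f n u v`: the number of Hamiltonian paths of `SG n` with end-vertex set `{u, v}`
(for `u ≠ v`, such unordered paths correspond bijectively to walks from `u` to `v`). -/
def f (n : ℕ) (u v : ℝ × ℝ) : ℕ := Nat.card {p : (G n).Walk u v // IsHamPath n p}

/-- `f1 n`: the number of Hamiltonian paths of `SG n` with end-vertex set `{o, a n}` -/
def f1 (n : ℕ) : ℕ := f n o (a n)

/-- the number of Hamiltonian cycles of `SG n`, counted up to starting vertex and
orientation: every Hamiltonian cycle passes through `o` and has exactly two
representatives as a closed walk based at `o`. -/
def HC (n : ℕ) : ℕ := Nat.card {p : (G n).Walk o o // IsHamCycle n p} / 2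

/-- the number of Hamiltonian paths of `SG n` having `o` as one of their end vertices -/
def H0 (n : ℕ) : ℕ := ∑ᶠ x ∈ {x : ℝ × ℝ | x ≠ o}, f n o x

/-- the total number of Hamiltonian paths of `SG n` (a path and its reversal
are the same unordered object, whence the division by `2`). -/
def H (n : ℕ) : ℕ := (∑ᶠ u : ℝ × ℝ, ∑ᶠ v : ℝ × ℝ, f n u v) / 2

/-- the distribution ratio `F(n,x) = f(n,x)/f1(n)` -/
def F (n : ℕ) (x : ℝ × ℝ) : ℝ := (f n o x : ℝ) / (f1 n : ℝ)

/-- `SG n` with the vertex `b n` (and its incident edges) deleted -/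
def Gd (n : ℕ) : SimpleGraph (ℝ × ℝ) := SimpleGraph.fromEdgeSet {e ∈ E n | b n ∉ e}

/-- Hamiltonian path of `SG n - b n` -/
def IsHamPathD (n : ℕ) {u v : ℝ × ℝ} (p : (Gd n).Walk u v) : Prop :=
  p.IsPath ∧ ∀ x, x ∈ p.support ↔ (x ∈ V n ∧ x ≠ b n)

/-- `g2 n x`: the number of Hamiltonian paths of `SG n - b n` with end-vertex set `{o, x}` -/
def g2 (n : ℕ) (x : ℝ × ℝ) : ℕ := Nat.card {p : (Gd n).Walk o x // IsHamPathD n p}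

/-- `g1 n`: the number of Hamiltonian paths of `SG n - b n` with end-vertex set `{o, a n}` -/
def g1 (n : ℕ) : ℕ := g2 n (a n)

/-- the distribution ratio `G₂(n,x) = g₂(n,x)/g₁(n)` -/
def G2 (n : ℕ) (x : ℝ × ℝ) : ℝ := (g2 n x : ℝ) / (g1 n : ℝ)

/-- mid-side vertex `a_{m,1} = (3·2^(m-1), 0)` -/
def a1 (m : ℕ) : ℝ × ℝ := (3 * (2:ℝ) ^ m / 2, 0)

/-- mid-side vertex `b_{m,1} = (5·2^(m-2), 2^(m-2)·√3)` -/
def b1 (m : ℕ) : ℝ × ℝ := (5 * (2:ℝ) ^ m / 4, (2:ℝ) ^ m / 4 * sq3)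

/-- mid-side vertex `c_{m,1} = (7·2^(m-2), 2^(m-2)·√3)` -/
def c1 (m : ℕ) : ℝ × ℝ := (7 * (2:ℝ) ^ m / 4, (2:ℝ) ^ m / 4 * sq3)

/-- mid-side vertex `a_{m,2} = (2^m, 2^(m-1)·√3)` -/
def a2 (m : ℕ) : ℝ × ℝ := ((2:ℝ) ^ m, (2:ℝ) ^ m / 2 * sq3)

/-- mid-side vertex `b_{m,2} = (3·2^(m-2), 3·2^(m-2)·√3)` -/
def b2 (m : ℕ) : ℝ × ℝ := (3 * (2:ℝ) ^ m / 4, 3 * (2:ℝ) ^ m / 4 * sq3)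

/-- mid-side vertex `c_{m,2} = (5·2^(m-2), 3·2^(m-2)·√3)` -/
def c2 (m : ℕ) : ℝ × ℝ := (5 * (2:ℝ) ^ m / 4, 3 * (2:ℝ) ^ m / 4 * sq3)

/-- exceptional vertex `a* = (2^(n-1), (2^(n-1)-1)·√3)` -/
def astar (n : ℕ) : ℝ × ℝ := ((2:ℝ) ^ n / 2, ((2:ℝ) ^ n / 2 - 1) * sq3)

/-- exceptional vertex `b* = (2^(n-1) - 1/2, (2^n-1)·√3/2)` -/
def bstar (n : ℕ) : ℝ × ℝ := ((2:ℝ) ^ n / 2 - 1/2, ((2:ℝ) ^ n - 1) * sq3 / 2)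

/-- exceptional vertex `c* = (2^(n-1) + 1/2, (2^n-1)·√3/2)` -/
def cstar (n : ℕ) : ℝ × ℝ := ((2:ℝ) ^ n / 2 + 1/2, ((2:ℝ) ^ n - 1) * sq3 / 2)

/-- the Euclidean norm on `ℝ × ℝ` -/
def enorm (x : ℝ × ℝ) : ℝ := Real.sqrt (x.1 ^ 2 + x.2 ^ 2)

/-- the set `C n` of corner vertices of `SG n` -/
def C (n : ℕ) : Finset (ℝ × ℝ) :=
  ((Finset.range (n + 1)).image a) ∪ ((Finset.range (n + 1)).image b) ∪
    ((Finset.range n).image c)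

/-- the mean `ℓ` displacement over the corner vertices -/
def xi' (n : ℕ) (ℓ : ℝ) : ℝ :=
  (∑ x ∈ C n, enorm x ^ ℓ * F n x) / (∑ x ∈ C n, F n x)

/-- `p(n,x)`: the probability that a Hamiltonian path with one end at `o`
has its other end at `x` -/
def p (n : ℕ) (x : ℝ × ℝ) : ℝ := (f n o x : ℝ) / (H0 n : ℝ)

/-- the mean `ℓ` displacement of Hamiltonian paths on `SG n` with one end at `o` -/
def xi (n : ℕ) (ℓ : ℝ) : ℝ :=
  ∑ᶠ x ∈ {x : ℝ × ℝ | x ∈ V n ∧ x ≠ o}, enorm x ^ ℓ * p n x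

/-- the partition function of Hamiltonian paths on `SG n` -/
def Z (n : ℕ) (β : ℝ) : ℝ := (H n : ℝ) * Real.exp (-(β * ((3 ^ (n + 1) + 1) / 2)))

/-! ### Boundary states and their gluing -/

/-- The boundary data of a spanning linear forest of a graph with three corners: the degrees of
the corners, which pairs of corners are connected, and which corners are connected to a marked
vertex. -/
structure BState where
  d0 : ℕ
  d1 : ℕ
  d2 : ℕ
  c01 : Bool
  c02 : Bool
  c12 : Bool
  m0 : Bool
  m1 : Bool
  m2 : Bool
deriving DecidableEq

namespace BState

/-- the degree of a corner -/
def d (σ : BState) : Fin 3 → ℕ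
  | 0 => σ.d0
  | 1 => σ.d1
  | 2 => σ.d2

/-- whether two corners are connected -/
def conn (σ : BState) : Fin 3 → Fin 3 → Bool
  | 0, 0 => true
  | 0, 1 => σ.c01
  | 0, 2 => σ.c02
  | 1, 0 => σ.c01
  | 1, 1 => true
  | 1, 2 => σ.c12
  | 2, 0 => σ.c02
  | 2, 1 => σ.c12
  | 2, 2 => true

/-- whether a corner is connected to a marked vertex -/
def mark (σ : BState) : Fin 3 → Bool
  | 0 => σ.m0
  | 1 => σ.m1
  | 2 => σ.m2

end BState

/-- The six corners of three glued pieces are numbered so that `k < 3` is the outer corner of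
piece `k`; `node i k` is the number of corner `k` of piece `i`. -/
def node : Fin 3 → Fin 3 → Fin 6
  | 0, 0 => 0
  | 0, 1 => 3
  | 0, 2 => 4
  | 1, 0 => 3
  | 1, 1 => 1
  | 1, 2 => 5
  | 2, 0 => 4
  | 2, 1 => 5
  | 2, 2 => 2

/-- the position of a node in a piece, if any -/
def pos : Fin 3 → Fin 6 → Option (Fin 3)
  | 0, 0 => some 0
  | 0, 3 => some 1
  | 0, 4 => some 2
  | 1, 3 => some 0
  | 1, 1 => some 1
  | 1, 5 => some 2
  | 2, 4 => some 0
  | 2, 5 => some 1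
  | 2, 2 => some 2
  | _, _ => none

/-- connectedness of two nodes inside one piece -/
def pieceConn (τ : BState) (i : Fin 3) (s t : Fin 6) : Bool :=
  match pos i s, pos i t with
  | some k, some l => τ.conn k l
  | _, _ => false

/-- connectedness of two nodes inside some piece -/
def baseConn (σ : Fin 3 → BState) (s t : Fin 6) : Bool :=
  pieceConn (σ 0) 0 s t || pieceConn (σ 1) 1 s t || pieceConn (σ 2) 2 s t

/-- one step of Warshall's algorithm -/
def warshall (r : Fin 6 → Fin 6 → Bool) (k s t : Fin 6) : Bool :=
  r s t || (r s k && r k t)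

/-- connectedness of two nodes in the union of the pieces -/
def nodeConn (σ : Fin 3 → BState) : Fin 6 → Fin 6 → Bool :=
  warshall (warshall (warshall (baseConn σ) 3) 4) 5

/-- the contribution of a piece to the degree of a node -/
def pieceDeg (τ : BState) (i : Fin 3) (s : Fin 6) : ℕ :=
  match pos i s with
  | some k => τ.d k
  | none => 0

/-- the degree of a node in the union of the pieces -/
def nodeDeg (σ : Fin 3 → BState) (s : Fin 6) : ℕ :=
  pieceDeg (σ 0) 0 s + pieceDeg (σ 1) 1 s + pieceDeg (σ 2) 2 s

/-- whether a node is connected to a marked vertex inside a piece -/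
def pieceMark (τ : BState) (i : Fin 3) (s : Fin 6) : Bool :=
  match pos i s with
  | some k => τ.mark k
  | none => false

/-- whether a node is marked, or connected to a marked vertex inside some piece -/
def nodeMark (J : Fin 6 → Bool) (σ : Fin 3 → BState) (s : Fin 6) : Bool :=
  J s || pieceMark (σ 0) 0 s || pieceMark (σ 1) 1 s || pieceMark (σ 2) 2 s

/-- a disjunction over the nodes -/
def anyNode (q : Fin 6 → Bool) : Bool :=
  q 0 || q 1 || q 2 || q 3 || q 4 || q 5

/-- admissibility of a junction -/
def junctionOk (J : Fin 6 → Bool) (σ : Fin 3 → BState) (s : Fin 6) : Bool :=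
  anyNode fun t => (nodeMark J σ t || Nat.ble (nodeDeg σ t) 1) && nodeConn σ s t

/-- whether linear forests with the given states glue to a linear forest -/
def glueOk (J : Fin 6 → Bool) (σ : Fin 3 → BState) : Bool :=
  (Nat.beq (nodeDeg σ 3) (bif J 3 then 1 else 2) && Nat.beq (nodeDeg σ 4) (bif J 4 then 1 else 2) &&
    Nat.beq (nodeDeg σ 5) (bif J 5 then 1 else 2)) &&
  (junctionOk J σ 3 && junctionOk J σ 4 && junctionOk J σ 5)

/-- the state of the union of three glued pieces -/
def glueState (J : Fin 6 → Bool) (σ : Fin 3 → BState) : BState where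
  d0 := nodeDeg σ 0
  d1 := nodeDeg σ 1
  d2 := nodeDeg σ 2
  c01 := nodeConn σ 0 1
  c02 := nodeConn σ 0 2
  c12 := nodeConn σ 1 2
  m0 := anyNode fun t => nodeMark J σ t && nodeConn σ 0 t
  m1 := anyNode fun t => nodeMark J σ t && nodeConn σ 1 t
  m2 := anyNode fun t => nodeMark J σ t && nodeConn σ 2 t

/-- a finitely supported weight on the states, as an association list -/
abbrev Weights := List (BState × ℕ)

/-- the weight of a state -/
def Weights.val (D : Weights) (σ : BState) : ℕ :=
  (D.map fun e => bif decide (e.1 = σ) then e.2 else 0).sum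

/-- add an entry to a list of weights, merging equal states -/
def Weights.insert (e : BState × ℕ) : Weights → Weights
  | [] => [e]
  | e' :: D => bif decide (e.1 = e'.1) then (e'.1, e.2 + e'.2) :: D else e' :: Weights.insert e D

/-- merge the entries with equal states -/
def Weights.merge : Weights → Weights
  | [] => []
  | e :: D => Weights.insert e (Weights.merge D)

/-- three states as a family -/
def triple {β : Type} (x y z : β) : Fin 3 → β
  | 0 => x
  | 1 => y
  | 2 => z

/-- the weights of the glued states -/
def glueWeights (J : Fin 6 → Bool) (D : Fin 3 → Weights) : Weights :=
  Weights.merge <| (D 0).flatMap fun x => (D 1).flatMap fun y => (D 2).flatMap fun z =>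
    bif glueOk J (triple x.1 y.1 z.1) then
      [(glueState J (triple x.1 y.1 z.1), x.2 * y.2 * z.2)] else []

/-! ### Graphs with three corners and their spanning linear forests -/

section Gadget

variable {α : Type*}

/-- the number of edges of `S` at `v` -/
def deg (S : Finset (Sym2 α)) (v : α) : ℕ := (S.filter (v ∈ ·)).card

/-- connectedness by edges of `S` -/
def Conn (S : Finset (Sym2 α)) : α → α → Prop := Relation.ReflTransGen fun u v => s(u, v) ∈ S

theorem Conn.symm {S : Finset (Sym2 α)} {u v : α} (h : Conn S u v) : Conn S v u := by
  have : Std.Symm fun u v : α => s(u, v) ∈ S := ⟨fun u v h => by rwa [Sym2.eq_swap]⟩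
  exact Std.Symm.symm (r := Relation.ReflTransGen fun u v : α => s(u, v) ∈ S) _ _ h

theorem Conn.trans {S : Finset (Sym2 α)} {u v w : α} (h : Conn S u v) (h' : Conn S v w) :
    Conn S u w :=
  Relation.ReflTransGen.trans h h'

theorem Conn.mono {S T : Finset (Sym2 α)} (hST : S ⊆ T) {u v : α} (h : Conn S u v) : Conn T u v :=
  Relation.ReflTransGen.mono (fun _ _ h => hST h) _ _ h

theorem deg_pos {S : Finset (Sym2 α)} {u v : α} (h : s(u, v) ∈ S) : 0 < deg S u :=
  Finset.card_pos.2 ⟨s(u, v), by simp [h]⟩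

theorem deg_mono {S T : Finset (Sym2 α)} (hST : S ⊆ T) (v : α) : deg S v ≤ deg T v :=
  Finset.card_le_card (Finset.filter_subset_filter _ hST)

/-- a finite loopless graph with three distinct corners -/
structure Gadget (α : Type*) where
  verts : Set α
  edges : Finset (Sym2 α)
  corner : Fin 3 → α
  mem_verts : ∀ e ∈ edges, ∀ v ∈ e, v ∈ verts
  not_isDiag : ∀ e ∈ edges, ¬ e.IsDiag
  corner_mem : ∀ i, corner i ∈ verts
  corner_injective : Function.Injective corner

/-- A spanning linear forest all of whose ends are corners or vertices in `X`, such that all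
vertices in `X` other than corners are ends. -/
def IsCover (g : Gadget α) (X : Set α) (S : Finset (Sym2 α)) : Prop :=
  S ⊆ g.edges ∧ (∀ i, deg S (g.corner i) ≤ 2) ∧
    (∀ v ∈ g.verts, v ∉ Set.range g.corner → deg S v = if v ∈ X then 1 else 2) ∧
    ∀ v ∈ g.verts, ∃ w ∈ g.verts, deg S w ≤ 1 ∧ Conn S v w

/-- connectedness to a marked vertex other than a corner -/
def Marked (g : Gadget α) (X : Set α) (S : Finset (Sym2 α)) (v : α) : Prop :=
  ∃ x ∈ g.verts, x ∉ Set.range g.corner ∧ x ∈ X ∧ Conn S v x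

/-- the boundary state of a set of edges -/
def state (g : Gadget α) (X : Set α) (S : Finset (Sym2 α)) : BState where
  d0 := deg S (g.corner 0)
  d1 := deg S (g.corner 1)
  d2 := deg S (g.corner 2)
  c01 := decide (Conn S (g.corner 0) (g.corner 1))
  c02 := decide (Conn S (g.corner 0) (g.corner 2))
  c12 := decide (Conn S (g.corner 1) (g.corner 2))
  m0 := decide (Marked g X S (g.corner 0))
  m1 := decide (Marked g X S (g.corner 1))
  m2 := decide (Marked g X S (g.corner 2))

theorem state_d (g : Gadget α) (X : Set α) (S : Finset (Sym2 α)) (i : Fin 3) :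
    (state g X S).d i = deg S (g.corner i) := by
  fin_cases i <;> rfl

theorem state_conn (g : Gadget α) (X : Set α) (S : Finset (Sym2 α)) (i j : Fin 3) :
    (state g X S).conn i j = true ↔ Conn S (g.corner i) (g.corner j) := by
  have hs : ∀ u v, Conn S u v ↔ Conn S v u := fun u v => ⟨Conn.symm, Conn.symm⟩
  have hr : ∀ u, Conn S u u := fun u => Relation.ReflTransGen.refl
  fin_cases i <;> fin_cases j <;> simp [state, BState.conn, hr] <;> exact hs _ _

theorem state_mark (g : Gadget α) (X : Set α) (S : Finset (Sym2 α)) (i : Fin 3) :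
    (state g X S).mark i = true ↔ Marked g X S (g.corner i) := by
  fin_cases i <;> simp [state, BState.mark]

/-- the number of spanning linear forests with a given boundary state -/
def count (g : Gadget α) (X : Set α) (σ : BState) : ℕ :=
  (g.edges.powerset.filter fun S => IsCover g X S ∧ state g X S = σ).card

theorem deg_eq_zero (g : Gadget α) {S : Finset (Sym2 α)} (hS : S ⊆ g.edges) {v : α}
    (hv : v ∉ g.verts) : deg S v = 0 := by
  rw [deg, Finset.card_eq_zero, Finset.filter_eq_empty_iff]
  exact fun e he hve => hv (g.mem_verts e (hS he) v hve)

/-! ### Gluing three pieces -/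

theorem pos_eq_some {i k : Fin 3} {s : Fin 6} : pos i s = some k ↔ node i k = s := by
  revert i k s; decide

theorem exists_node (s : Fin 6) : ∃ i k, node i k = s := by
  revert s; decide

theorem node_symm (i j : Fin 3) : node i j = node j i := by
  revert i j; decide

/-- `g` consists of three pieces, any two of which share a corner -/
structure Gluing (g : Gadget α) (h : Fin 3 → Gadget α) : Prop where
  verts : ∀ v, v ∈ g.verts ↔ ∃ i, v ∈ (h i).verts
  edges : ∀ e, e ∈ g.edges ↔ ∃ i, e ∈ (h i).edges
  corner : ∀ k, g.corner k = (h k).corner k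
  symm : ∀ i j, (h i).corner j = (h j).corner i
  inter : ∀ i j, i ≠ j → ∀ v, v ∈ (h i).verts → v ∈ (h j).verts → v = (h i).corner j

/-- the vertices corresponding to the nodes -/
def nodeVertex (h : Fin 3 → Gadget α) : Fin 6 → α
  | 0 => (h 0).corner 0
  | 1 => (h 1).corner 1
  | 2 => (h 2).corner 2
  | 3 => (h 0).corner 1
  | 4 => (h 0).corner 2
  | 5 => (h 1).corner 2

theorem pieceConn_iff (g : Gadget α) (X : Set α) (S : Finset (Sym2 α)) (i : Fin 3) (s t : Fin 6) :
    pieceConn (state g X S) i s t = true ↔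
      ∃ k l, node i k = s ∧ node i l = t ∧ Conn S (g.corner k) (g.corner l) := by
  rw [pieceConn]
  constructor
  · split
    · next k l hk hl =>
      rw [pos_eq_some] at hk hl
      rw [state_conn]
      exact fun hc => ⟨k, l, hk, hl, hc⟩
    · simp
  · rintro ⟨k, l, hk, hl, hc⟩
    rw [← pos_eq_some] at hk hl
    rw [hk, hl]
    exact (state_conn _ _ _ _ _).2 hc

theorem baseConn_iff (h : Fin 3 → Gadget α) (X : Set α) (P : Fin 3 → Finset (Sym2 α))
    (s t : Fin 6) :
    baseConn (fun i => state (h i) X (P i)) s t = true ↔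
      ∃ i k l, node i k = s ∧ node i l = t ∧ Conn (P i) ((h i).corner k) ((h i).corner l) := by
  simp only [baseConn, Bool.or_eq_true, pieceConn_iff]
  constructor
  · rintro ((hh | hh) | hh)
    exacts [⟨0, hh⟩, ⟨1, hh⟩, ⟨2, hh⟩]
  · rintro ⟨i, hh⟩
    fin_cases i
    exacts [.inl (.inl hh), .inl (.inr hh), .inr hh]

theorem pieceMark_iff (g : Gadget α) (X : Set α) (S : Finset (Sym2 α)) (i : Fin 3) (s : Fin 6) :
    pieceMark (state g X S) i s = true ↔ ∃ k, node i k = s ∧ Marked g X S (g.corner k) := by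
  rw [pieceMark]
  constructor
  · split
    · next k hk =>
      rw [pos_eq_some] at hk
      rw [state_mark]
      exact fun hc => ⟨k, hk, hc⟩
    · simp
  · rintro ⟨k, hk, hc⟩
    rw [← pos_eq_some] at hk
    rw [hk]
    exact (state_mark _ _ _ _).2 hc

theorem nodeMark_iff (h : Fin 3 → Gadget α) (X : Set α) (P : Fin 3 → Finset (Sym2 α))
    (J : Fin 6 → Bool) (s : Fin 6) :
    nodeMark J (fun i => state (h i) X (P i)) s = true ↔
      J s = true ∨ ∃ i k, node i k = s ∧ Marked (h i) X (P i) ((h i).corner k) := by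
  simp only [nodeMark, Bool.or_eq_true, pieceMark_iff]
  constructor
  · rintro (((hh | hh) | hh) | hh)
    exacts [.inl hh, .inr ⟨0, hh⟩, .inr ⟨1, hh⟩, .inr ⟨2, hh⟩]
  · rintro (hh | ⟨i, hh⟩)
    · exact .inl (.inl (.inl hh))
    · fin_cases i
      exacts [.inl (.inl (.inr hh)), .inl (.inr hh), .inr hh]

theorem anyNode_iff (q : Fin 6 → Bool) : anyNode q = true ↔ ∃ t, q t = true := by
  simp only [anyNode, Bool.or_eq_true]
  constructor
  · rintro (((((hh | hh) | hh) | hh) | hh) | hh)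
    exacts [⟨0, hh⟩, ⟨1, hh⟩, ⟨2, hh⟩, ⟨3, hh⟩, ⟨4, hh⟩, ⟨5, hh⟩]
  · rintro ⟨t, hh⟩
    fin_cases t <;> simp_all

/-- transitivity of a relation through a given node -/
def TransAt (r : Fin 6 → Fin 6 → Bool) (k : Fin 6) : Prop :=
  ∀ s t, r s k = true → r k t = true → r s t = true

theorem transAt_warshall_self (r : Fin 6 → Fin 6 → Bool) (k : Fin 6) :
    TransAt (warshall r k) k := by
  intro s t
  simp only [warshall, Bool.or_eq_true, Bool.and_eq_true]
  tauto

theorem TransAt.warshall {r : Fin 6 → Fin 6 → Bool} {j : Fin 6} (hr : TransAt r j) (k : Fin 6) :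
    TransAt (warshall r k) j := by
  intro s t
  have h1 := hr s t
  have h2 := hr s k
  have h3 := hr k t
  have h4 := hr k k
  simp only [SierpinskiGasket.warshall, Bool.or_eq_true, Bool.and_eq_true] at *
  tauto

theorem nodeConn_of_baseConn {σ : Fin 3 → BState} {s t : Fin 6} (hst : baseConn σ s t = true) :
    nodeConn σ s t = true := by
  simp [nodeConn, warshall, hst]

theorem transAt_baseConn (h : Fin 3 → Gadget α) (X : Set α) (P : Fin 3 → Finset (Sym2 α))
    (k : Fin 3) : TransAt (baseConn fun i => state (h i) X (P i)) (node k k) := by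
  intro s t
  simp only [baseConn_iff]
  rintro ⟨i, a₁, b₁, rfl, hb, hc⟩ ⟨i', a₂, b₂, ha, rfl, hc'⟩
  have key : ∀ i b k : Fin 3, node i b = node k k → i = k ∧ b = k := by decide
  obtain ⟨rfl, rfl⟩ := key _ _ _ hb
  obtain ⟨rfl, rfl⟩ := key _ _ _ ha
  exact ⟨_, _, _, rfl, rfl, hc.trans hc'⟩

theorem nodeConn_trans (h : Fin 3 → Gadget α) (X : Set α) (P : Fin 3 → Finset (Sym2 α))
    {s k t : Fin 6} (hsk : nodeConn (fun i => state (h i) X (P i)) s k = true)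
    (hkt : nodeConn (fun i => state (h i) X (P i)) k t = true) :
    nodeConn (fun i => state (h i) X (P i)) s t = true := by
  refine (?_ : TransAt _ k) s t hsk hkt
  fin_cases k
  · exact (((transAt_baseConn h X P 0).warshall 3).warshall 4).warshall 5
  · exact (((transAt_baseConn h X P 1).warshall 3).warshall 4).warshall 5
  · exact (((transAt_baseConn h X P 2).warshall 3).warshall 4).warshall 5
  · exact ((transAt_warshall_self _ 3).warshall 4).warshall 5
  · exact (transAt_warshall_self _ 4).warshall 5
  · exact transAt_warshall_self _ 5

theorem conn_of_warshall {S : Finset (Sym2 α)} {x : Fin 6 → α} {r : Fin 6 → Fin 6 → Bool}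
    (hr : ∀ s t, r s t = true → Conn S (x s) (x t)) (k : Fin 6) :
    ∀ s t, warshall r k s t = true → Conn S (x s) (x t) := by
  intro s t
  simp only [warshall, Bool.or_eq_true, Bool.and_eq_true]
  rintro (hst | ⟨hsk, hkt⟩)
  · exact hr _ _ hst
  · exact (hr _ _ hsk).trans (hr _ _ hkt)

namespace Gluing

variable {g : Gadget α} {h : Fin 3 → Gadget α} (H : Gluing g h)

include H

theorem nodeVertex_node (i k : Fin 3) : nodeVertex h (node i k) = (h i).corner k := by
  have := H.symm
  fin_cases i <;> fin_cases k <;> first | rfl | exact H.symm _ _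

theorem nodeVertex_mem {i : Fin 3} {s : Fin 6} (hs : nodeVertex h s ∈ (h i).verts) :
    ∃ k, node i k = s := by
  obtain ⟨j, l, rfl⟩ := exists_node s
  rw [H.nodeVertex_node] at hs
  by_cases hij : i = j
  · exact ⟨l, by rw [hij]⟩
  · have := H.inter j i (Ne.symm hij) _ ((h j).corner_mem l) hs
    have hl := (h j).corner_injective this
    exact ⟨j, by rw [hl, node_symm]⟩

theorem edges_disjoint {i j : Fin 3} (hij : i ≠ j) : Disjoint (h i).edges (h j).edges := by
  rw [Finset.disjoint_left]
  intro e hi hj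
  induction e with
  | h u v =>
    have hu := H.inter i j hij u ((h i).mem_verts _ hi _ (by simp))
      ((h j).mem_verts _ hj _ (by simp))
    have hv := H.inter i j hij v ((h i).mem_verts _ hi _ (by simp))
      ((h j).mem_verts _ hj _ (by simp))
    exact (h i).not_isDiag _ hi (by simp [hu, hv])

variable {S : Finset (Sym2 α)} {P : Fin 3 → Finset (Sym2 α)} (hP : ∀ i, P i ⊆ (h i).edges)
  (hS : ∀ e, e ∈ S ↔ ∃ i, e ∈ P i)

include hP hS

theorem deg_eq (v : α) : deg S v = ∑ i, deg (P i) v := by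
  have : S.filter (v ∈ ·) = Finset.univ.biUnion fun i => (P i).filter (v ∈ ·) := by
    ext e; simp [hS]
  rw [deg, this, Finset.card_biUnion]
  · rfl
  · intro i _ j _ hij
    exact ((H.edges_disjoint hij).mono (hP i) (hP j)).mono (Finset.filter_subset _ _)
      (Finset.filter_subset _ _)

omit hS in
theorem pieceDeg_eq (X : Set α) (i : Fin 3) (s : Fin 6) :
    pieceDeg (state (h i) X (P i)) i s = deg (P i) (nodeVertex h s) := by
  rw [pieceDeg]
  split
  · next k hk =>
    rw [pos_eq_some] at hk
    rw [state_d, ← hk, H.nodeVertex_node]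
  · next hk =>
    rw [deg_eq_zero (h i) (hP i)]
    intro hs
    obtain ⟨k, hk'⟩ := H.nodeVertex_mem hs
    rw [← pos_eq_some, hk] at hk'
    cases hk'

theorem nodeDeg_eq (X : Set α) (s : Fin 6) :
    nodeDeg (fun i => state (h i) X (P i)) s = deg S (nodeVertex h s) := by
  rw [H.deg_eq hP hS, Fin.sum_univ_three]
  simp only [nodeDeg, H.pieceDeg_eq hP]


omit hP in
theorem conn_of_nodeConn (X : Set α) {s t : Fin 6}
    (hst : nodeConn (fun i => state (h i) X (P i)) s t = true) :
    Conn S (nodeVertex h s) (nodeVertex h t) := by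
  refine conn_of_warshall (conn_of_warshall (conn_of_warshall ?_ 3) 4) 5 s t hst
  intro s t hst
  rw [baseConn_iff] at hst
  obtain ⟨i, k, l, rfl, rfl, hc⟩ := hst
  rw [H.nodeVertex_node, H.nodeVertex_node]
  exact hc.mono fun e he => (hS e).2 ⟨i, he⟩

theorem exists_nodeConn (X : Set α) {s : Fin 6} {w : α} (hw : Conn S (nodeVertex h s) w) (i : Fin 3)
    (hwi : w ∈ (h i).verts) :
    ∃ k, nodeConn (fun i => state (h i) X (P i)) s (node i k) = true ∧
      Conn (P i) ((h i).corner k) w := by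
  have hbase : ∀ i k l, Conn (P i) ((h i).corner k) ((h i).corner l) →
      nodeConn (fun i => state (h i) X (P i)) (node i k) (node i l) = true := fun i k l hc =>
    nodeConn_of_baseConn ((baseConn_iff _ _ _ _ _).2 ⟨i, k, l, rfl, rfl, hc⟩)
  induction hw generalizing i with
  | refl =>
    obtain ⟨k, rfl⟩ := H.nodeVertex_mem hwi
    refine ⟨k, hbase _ _ _ .refl, ?_⟩
    rw [H.nodeVertex_node]
    exact .refl
  | @tail w w' _ hww' ih =>
    obtain ⟨j, hj⟩ := (hS _).1 hww'
    have hwj := (h j).mem_verts _ (hP j hj) w (by simp)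
    have hwj' := (h j).mem_verts _ (hP j hj) w' (by simp)
    obtain ⟨k, hk, hkw⟩ := ih j hwj
    have hkw' : Conn (P j) ((h j).corner k) w' := hkw.tail hj
    by_cases hij : i = j
    · subst hij
      exact ⟨k, hk, hkw'⟩
    · have hw' := H.inter j i (Ne.symm hij) _ hwj' hwi
      refine ⟨j, nodeConn_trans h X P hk (node_symm i j ▸ hbase j k i (hw' ▸ hkw')), ?_⟩
      rw [hw', H.symm]
      exact .refl

theorem nodeConn_iff (X : Set α) (s t : Fin 6) :
    nodeConn (fun i => state (h i) X (P i)) s t = true ↔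
      Conn S (nodeVertex h s) (nodeVertex h t) := by
  refine ⟨H.conn_of_nodeConn hS X, fun hc => ?_⟩
  obtain ⟨i, l, rfl⟩ := exists_node t
  rw [H.nodeVertex_node] at hc
  obtain ⟨k, hk, hkl⟩ := H.exists_nodeConn hP hS X hc i ((h i).corner_mem l)
  exact nodeConn_trans h X P hk
    (nodeConn_of_baseConn ((baseConn_iff _ _ _ _ _).2 ⟨i, k, l, rfl, rfl, hkl⟩))

/-- The conditions for a node to be connected to some marked vertex. -/
theorem marked_iff {X : Set α} {J : Fin 6 → Bool} (hJ : ∀ s, J s = true ↔ nodeVertex h s ∈ X)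
    (hX : ∀ k, g.corner k ∉ X) (s : Fin 6) :
    (anyNode fun t => nodeMark J (fun i => state (h i) X (P i)) t &&
      nodeConn (fun i => state (h i) X (P i)) s t) = true ↔ Marked g X S (nodeVertex h s) := by
  simp only [anyNode_iff, Bool.and_eq_true, nodeMark_iff]
  constructor
  · rintro ⟨t, ht | ⟨i, k, rfl, x, hx, hxc, hxX, hkx⟩, hst⟩
    · obtain ⟨i, k, rfl⟩ := exists_node t
      rw [hJ] at ht
      refine ⟨_, (H.verts _).2 ⟨i, ?_⟩, ?_, ht, H.conn_of_nodeConn hS X hst⟩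
      · rw [H.nodeVertex_node]
        exact (h i).corner_mem k
      · rintro ⟨l, hl⟩
        exact hX l (hl ▸ ht)
    · refine ⟨x, (H.verts _).2 ⟨i, hx⟩, ?_, hxX, (H.conn_of_nodeConn hS X hst).trans ?_⟩
      · rintro ⟨l, rfl⟩
        exact hX l hxX
      · rw [H.nodeVertex_node]
        exact hkx.mono fun e he => (hS e).2 ⟨i, he⟩
  · rintro ⟨x, hx, -, hxX, hc⟩
    obtain ⟨i, hi⟩ := (H.verts x).1 hx
    obtain ⟨k, hk, hkx⟩ := H.exists_nodeConn hP hS X hc i hi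
    by_cases hxc : x ∈ Set.range (h i).corner
    · obtain ⟨l, rfl⟩ := hxc
      refine ⟨node i l, .inl ((hJ _).2 ?_), (H.nodeConn_iff hP hS X _ _).2 ?_⟩
      · rwa [H.nodeVertex_node]
      · rwa [H.nodeVertex_node]
    · exact ⟨node i k, .inr ⟨i, k, rfl, x, hi, hxc, hxX, hkx⟩, hk⟩

theorem state_eq {X : Set α} {J : Fin 6 → Bool} (hJ : ∀ s, J s = true ↔ nodeVertex h s ∈ X)
    (hX : ∀ k, g.corner k ∉ X) :
    state g X S = glueState J fun i => state (h i) X (P i) := by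
  have hc : ∀ k : Fin 3, g.corner k = nodeVertex h (node k k) := fun k => by
    rw [H.nodeVertex_node, H.corner]
  have e0 := hc 0
  have e1 := hc 1
  have e2 := hc 2
  rw [glueState, state, e0, e1, e2]
  congr 1
  · exact (H.nodeDeg_eq hP hS X 0).symm
  · exact (H.nodeDeg_eq hP hS X 1).symm
  · exact (H.nodeDeg_eq hP hS X 2).symm
  · rw [Bool.eq_iff_iff, decide_eq_true_eq]; exact (H.nodeConn_iff hP hS X 0 1).symm
  · rw [Bool.eq_iff_iff, decide_eq_true_eq]; exact (H.nodeConn_iff hP hS X 0 2).symm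
  · rw [Bool.eq_iff_iff, decide_eq_true_eq]; exact (H.nodeConn_iff hP hS X 1 2).symm
  · rw [Bool.eq_iff_iff, decide_eq_true_eq]; exact (H.marked_iff hP hS hJ hX 0).symm
  · rw [Bool.eq_iff_iff, decide_eq_true_eq]; exact (H.marked_iff hP hS hJ hX 1).symm
  · rw [Bool.eq_iff_iff, decide_eq_true_eq]; exact (H.marked_iff hP hS hJ hX 2).symm

theorem deg_of_not_corner {i : Fin 3} {v : α} (hv : v ∈ (h i).verts)
    (hvc : v ∉ Set.range (h i).corner) : deg S v = deg (P i) v := by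
  rw [H.deg_eq hP hS, Finset.sum_eq_single i]
  · intro j _ hji
    apply deg_eq_zero (h j) (hP j)
    intro hvj
    exact hvc ⟨j, (H.inter i j (Ne.symm hji) v hv hvj).symm⟩
  · simp

/-- the degree condition at the junctions -/
theorem junction_deg_iff {X : Set α} {J : Fin 6 → Bool} (hJ : ∀ s, J s = true ↔ nodeVertex h s ∈ X)
    (s : Fin 6) :
    Nat.beq (nodeDeg (fun i => state (h i) X (P i)) s) (bif J s then 1 else 2) = true ↔
      deg S (nodeVertex h s) = if nodeVertex h s ∈ X then 1 else 2 := by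
  rw [Nat.beq_eq, H.nodeDeg_eq hP hS]
  by_cases hs : nodeVertex h s ∈ X
  · simp [hs, (hJ s).2 hs]
  · have : J s = false := by rw [← Bool.not_eq_true, hJ]; exact hs
    simp [hs, this]

omit hP hS in
theorem junction_not_corner {i j : Fin 3} (hij : i ≠ j) :
    (h i).corner j ∉ Set.range g.corner := by
  rintro ⟨k, hk⟩
  rw [H.corner] at hk
  have key : ∀ i j k : Fin 3, i ≠ j → node i j ≠ node k k := by decide
  by_cases hik : i = k
  · subst hik
    exact hij ((h i).corner_injective hk)
  · have h1 : (h k).corner k ∈ (h i).verts := hk ▸ (h i).corner_mem j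
    have := H.inter k i (Ne.symm hik) _ ((h k).corner_mem k) h1
    exact hik ((h k).corner_injective this).symm

omit hP hS in
theorem not_corner {i : Fin 3} {v : α} (hv : v ∈ (h i).verts) (hvc : v ∉ Set.range (h i).corner) :
    v ∉ Set.range g.corner := by
  rintro ⟨k, rfl⟩
  rw [H.corner] at hv hvc
  by_cases hik : i = k
  · subst hik
    exact hvc ⟨i, rfl⟩
  · exact hvc ⟨k, (H.inter i k hik _ hv ((h k).corner_mem k)).symm⟩

theorem deg_corner (k : Fin 3) : deg S (g.corner k) = deg (P k) ((h k).corner k) := by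
  rw [H.corner, H.deg_eq hP hS, Finset.sum_eq_single k]
  · intro j _ hjk
    apply deg_eq_zero (h j) (hP j)
    intro hvj
    have := H.inter k j (Ne.symm hjk) _ ((h k).corner_mem k) hvj
    exact hjk ((h k).corner_injective this).symm
  · simp

omit H hP hS in
theorem glueOk_iff (J : Fin 6 → Bool) (σ : Fin 3 → BState) :
    glueOk J σ = true ↔ ∀ i j, i ≠ j →
      Nat.beq (nodeDeg σ (node i j)) (bif J (node i j) then 1 else 2) = true ∧
        junctionOk J σ (node i j) = true := by
  simp only [glueOk, Bool.and_eq_true]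
  constructor
  · rintro ⟨⟨⟨h3, h4⟩, h5⟩, ⟨h3', h4'⟩, h5'⟩ i j hij
    fin_cases i <;> fin_cases j <;>
      first
      | exact absurd rfl hij
      | exact ⟨h3, h3'⟩
      | exact ⟨h4, h4'⟩
      | exact ⟨h5, h5'⟩
  · intro hh
    have h3 := hh 0 1 (by decide)
    have h4 := hh 0 2 (by decide)
    have h5 := hh 1 2 (by decide)
    exact ⟨⟨⟨h3.1, h4.1⟩, h5.1⟩, ⟨h3.2, h4.2⟩, h5.2⟩

omit H hP hS in
theorem _root_.SierpinskiGasket.IsCover.deg_le {g : Gadget α} {X : Set α} {S : Finset (Sym2 α)}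
    (hC : IsCover g X S) {v : α} (hv : v ∈ g.verts) : deg S v ≤ 2 := by
  by_cases hvc : v ∈ Set.range g.corner
  · obtain ⟨k, rfl⟩ := hvc
    exact hC.2.1 k
  · rw [hC.2.2.1 v hv hvc]
    split <;> omega

theorem isCover_piece {X : Set α} (hC : IsCover g X S) (i : Fin 3) : IsCover (h i) X (P i) := by
  have hsub : P i ⊆ S := fun e he => (hS e).2 ⟨i, he⟩
  refine ⟨hP i, fun k => ?_, fun v hv hvc => ?_, fun v hv => ?_⟩
  · exact (deg_mono hsub _).trans (hC.deg_le ((H.verts _).2 ⟨i, (h i).corner_mem k⟩))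
  · rw [← H.deg_of_not_corner hP hS hv hvc]
    exact hC.2.2.1 v ((H.verts _).2 ⟨i, hv⟩) (H.not_corner hv hvc)
  · by_contra! hcon
    obtain ⟨w, -, hwd, hvw⟩ := hC.2.2.2 v ((H.verts _).2 ⟨i, hv⟩)
    have : w ∈ (h i).verts ∧ Conn (P i) v w := by
      clear hwd
      induction hvw with
      | refl => exact ⟨hv, .refl⟩
      | @tail u u' _ huu' ih =>
        obtain ⟨j, hj⟩ := (hS _).1 huu'
        by_cases hij : i = j
        · subst hij
          exact ⟨(h i).mem_verts _ (hP i hj) _ (by simp), ih.2.tail hj⟩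
        · exfalso
          have h1 : 1 < deg (P i) u := by
            by_contra! hle
            exact hcon u ih.1 hle ih.2
          have h2 := deg_pos hj
          have h3 := hC.deg_le ((H.verts u).2 ⟨i, ih.1⟩)
          rw [H.deg_eq hP hS] at h3
          have h4 := Finset.sum_le_sum_of_subset (f := fun i => deg (P i) u)
            (Finset.subset_univ {i, j})
          rw [Finset.sum_pair hij] at h4
          omega
    exact hcon w this.1 ((deg_mono hsub w).trans hwd) this.2

theorem isCover_iff {X : Set α} {J : Fin 6 → Bool} (hJ : ∀ s, J s = true ↔ nodeVertex h s ∈ X)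
    (hX : ∀ k, g.corner k ∉ X) :
    IsCover g X S ↔ (∀ i, IsCover (h i) X (P i)) ∧
      glueOk J (fun i => state (h i) X (P i)) = true := by
  rw [glueOk_iff]
  constructor
  · refine fun hC => ⟨H.isCover_piece hP hS hC, fun i j hij => ?_⟩
    have hv : (h i).corner j ∈ g.verts := (H.verts _).2 ⟨i, (h i).corner_mem j⟩
    refine ⟨?_, ?_⟩
    · rw [H.junction_deg_iff hP hS hJ, H.nodeVertex_node]
      exact hC.2.2.1 _ hv (H.junction_not_corner hij)
    · obtain ⟨w, hw, hwd, hvw⟩ := hC.2.2.2 _ hv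
      obtain ⟨i', hi'⟩ := (H.verts w).1 hw
      rw [← H.nodeVertex_node] at hvw
      obtain ⟨k, hk, hkw⟩ := H.exists_nodeConn hP hS X hvw i' hi'
      simp only [junctionOk, anyNode_iff, Bool.and_eq_true, Bool.or_eq_true, Nat.ble_eq,
        H.nodeDeg_eq hP hS, nodeMark_iff]
      by_cases hwc : w ∈ Set.range (h i').corner
      · obtain ⟨l, rfl⟩ := hwc
        refine ⟨node i' l, .inr ?_, (H.nodeConn_iff hP hS X _ _).2 ?_⟩
        · rwa [H.nodeVertex_node]
        · rwa [H.nodeVertex_node i' l]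
      · refine ⟨node i' k, .inl (.inr ⟨i', k, rfl, w, hi', hwc, ?_, hkw⟩), hk⟩
        have := hC.2.2.1 w hw (H.not_corner hi' hwc)
        by_contra hwX
        rw [if_neg hwX] at this
        omega
  · rintro ⟨hC, hG⟩
    have hdeg : ∀ v ∈ g.verts, v ∉ Set.range g.corner → deg S v = if v ∈ X then 1 else 2 := by
      intro v hv hvc
      obtain ⟨i, hi⟩ := (H.verts v).1 hv
      by_cases hvi : v ∈ Set.range (h i).corner
      · obtain ⟨j, rfl⟩ := hvi
        have hij : i ≠ j := by
          rintro rfl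
          exact hvc ⟨i, H.corner i⟩
        have := (hG i j hij).1
        rwa [H.junction_deg_iff hP hS hJ, H.nodeVertex_node] at this
      · rw [H.deg_of_not_corner hP hS hi hvi]
        exact (hC i).2.2.1 v hi hvi
    refine ⟨fun e he => ?_, fun k => ?_, hdeg, fun v hv => ?_⟩
    · obtain ⟨i, hi⟩ := (hS e).1 he
      exact (H.edges e).2 ⟨i, hP i hi⟩
    · rw [H.deg_corner hP hS]
      exact (hC k).2.1 k
    · obtain ⟨i, hi⟩ := (H.verts v).1 hv
      obtain ⟨w, hw, hwd, hvw⟩ := (hC i).2.2.2 v hi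
      have hvw' : Conn S v w := hvw.mono fun e he => (hS e).2 ⟨i, he⟩
      by_cases hwi : w ∈ Set.range (h i).corner
      · obtain ⟨j, rfl⟩ := hwi
        by_cases hij : i = j
        · subst hij
          refine ⟨_, (H.verts _).2 ⟨i, hw⟩, ?_, hvw'⟩
          rwa [← H.corner, H.deg_corner hP hS]
        · have hG := (hG i j hij).2
          simp only [junctionOk, anyNode_iff, Bool.and_eq_true, Bool.or_eq_true, Nat.ble_eq] at hG
          obtain ⟨t, ht | ht, hct⟩ := hG
          · have := (H.marked_iff hP hS hJ hX (node i j)).1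
              ((anyNode_iff _).2 ⟨t, by rw [ht, hct]; rfl⟩)
            obtain ⟨x, hx, hxc, hxX, hcx⟩ := this
            rw [H.nodeVertex_node] at hcx
            exact ⟨x, hx, by rw [hdeg x hx hxc, if_pos hxX], hvw'.trans hcx⟩
          · rw [H.nodeDeg_eq hP hS] at ht
            have hct := H.conn_of_nodeConn hS X hct
            rw [H.nodeVertex_node] at hct
            refine ⟨_, ?_, ht, hvw'.trans hct⟩
            obtain ⟨i', k, rfl⟩ := exists_node t
            rw [H.nodeVertex_node]
            exact (H.verts _).2 ⟨i', (h i').corner_mem k⟩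
      · exact ⟨w, (H.verts _).2 ⟨i, hw⟩, by rwa [H.deg_of_not_corner hP hS hw hwi], hvw'⟩

omit hP hS in
/-- The transfer formula: forests of the glued graph correspond to triples of forests. -/
theorem count_eq {X : Set α} {J : Fin 6 → Bool} (hJ : ∀ s, J s = true ↔ nodeVertex h s ∈ X)
    (hX : ∀ k, g.corner k ∉ X) (L : Fin 3 → Finset BState)
    (hL : ∀ i σ, count (h i) X σ ≠ 0 → σ ∈ L i) (τ : BState) :
    count g X τ = ∑ σ ∈ Fintype.piFinset L,
      if glueOk J σ = true ∧ glueState J σ = τ then ∏ i, count (h i) X (σ i) else 0 := by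
  set T : Finset (Fin 3 → Finset (Sym2 α)) :=
    (Fintype.piFinset fun i => (h i).edges.powerset).filter fun P =>
      (∀ i, IsCover (h i) X (P i)) ∧ glueOk J (fun i => state (h i) X (P i)) = true ∧
        glueState J (fun i => state (h i) X (P i)) = τ with hT
  have h1 : count g X τ = T.card := by
    symm
    refine Finset.card_nbij' (fun P => Finset.univ.biUnion P) (fun S i => S ∩ (h i).edges)
      ?_ ?_ ?_ ?_
    · intro P hPT
      simp only [hT, Finset.coe_filter, Fintype.mem_piFinset, Finset.mem_powerset,
        Set.mem_ofPred_eq] at hPT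
      obtain ⟨hP, hC, hG, hτ⟩ := hPT
      have hS : ∀ e, e ∈ Finset.univ.biUnion P ↔ ∃ i, e ∈ P i := by simp
      simp only [Finset.coe_filter, Finset.mem_powerset, Set.mem_ofPred_eq]
      have hC' := (H.isCover_iff hP hS hJ hX).2 ⟨hC, hG⟩
      exact ⟨hC'.1, hC', by rw [H.state_eq hP hS hJ hX, hτ]⟩
    · intro S hST
      simp only [Finset.coe_filter, Finset.mem_powerset, Set.mem_ofPred_eq] at hST
      obtain ⟨hSg, hC, hτ⟩ := hST
      have hP : ∀ i, S ∩ (h i).edges ⊆ (h i).edges := fun i => Finset.inter_subset_right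
      have hS : ∀ e, e ∈ S ↔ ∃ i, e ∈ S ∩ (h i).edges := fun e => by
        have := H.edges e
        simp only [Finset.mem_inter, exists_and_left, ← this]
        exact ⟨fun he => ⟨he, hSg he⟩, fun he => he.1⟩
      simp only [hT, Finset.coe_filter, Fintype.mem_piFinset, Finset.mem_powerset,
        Set.mem_ofPred_eq]
      have := (H.isCover_iff hP hS hJ hX).1 hC
      exact ⟨hP, this.1, this.2, by rw [← H.state_eq hP hS hJ hX, hτ]⟩
    · intro P hPT
      simp only [hT, Finset.coe_filter, Fintype.mem_piFinset, Finset.mem_powerset,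
        Set.mem_ofPred_eq] at hPT
      obtain ⟨hP, -⟩ := hPT
      funext i
      ext e
      simp only [Finset.mem_inter, Finset.mem_biUnion, Finset.mem_univ, true_and]
      constructor
      · rintro ⟨⟨j, hj⟩, hi⟩
        by_cases hij : i = j
        · rwa [hij]
        · exact absurd (hP j hj) (Finset.disjoint_left.1 (H.edges_disjoint hij) hi)
      · exact fun he => ⟨⟨i, he⟩, hP i he⟩
    · intro S hST
      simp only [Finset.coe_filter, Finset.mem_powerset, Set.mem_ofPred_eq] at hST
      ext e
      simp only [Finset.mem_inter, Finset.mem_biUnion, Finset.mem_univ, true_and,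
        exists_and_left, ← H.edges e]
      exact ⟨fun he => he.1, fun he => ⟨he, hST.1 he⟩⟩
  have hmaps : Set.MapsTo (fun P i => state (h i) X (P i)) (T : Set (Fin 3 → Finset (Sym2 α)))
      (Fintype.piFinset L : Set (Fin 3 → BState)) := by
    intro P hPT
    simp only [hT, Finset.coe_filter, Fintype.mem_piFinset, Finset.mem_powerset,
        Set.mem_ofPred_eq] at hPT
    rw [Finset.mem_coe, Fintype.mem_piFinset]
    intro i
    apply hL
    rw [count, Finset.card_ne_zero]
    exact ⟨P i, by simpa using ⟨hPT.1 i, hPT.2.1 i⟩⟩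
  rw [h1, Finset.card_eq_sum_card_fiberwise hmaps]
  refine Finset.sum_congr rfl fun σ _ => ?_
  split
  · next hG =>
    rw [show (∏ i, count (h i) X (σ i)) = (Fintype.piFinset fun i => (h i).edges.powerset.filter
      fun S => IsCover (h i) X S ∧ state (h i) X S = σ i).card from
        (Fintype.card_piFinset _).symm]
    congr 1
    ext P
    simp only [hT, Finset.mem_filter, Fintype.mem_piFinset, Finset.mem_powerset]
    constructor
    · rintro ⟨⟨hP, hC, -⟩, rfl⟩ i
      exact ⟨hP i, hC i, rfl⟩
    · intro hh
      have : (fun i => state (h i) X (P i)) = σ := funext fun i => (hh i).2.2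
      rw [this]
      exact ⟨⟨fun i => (hh i).1, fun i => (hh i).2.1, hG⟩, rfl⟩
  · next hG =>
    rw [Finset.card_eq_zero, Finset.filter_eq_empty_iff]
    rintro P hPT rfl
    simp only [hT, Finset.mem_filter] at hPT
    exact hG hPT.2.2

end Gluing
end Gadget
/-! ### Computing with weights -/

theorem triple_eta {β : Type} (x : Fin 3 → β) : triple (x 0) (x 1) (x 2) = x := by
  funext i; fin_cases i <;> rfl

namespace Weights

theorem val_nil (σ : BState) : val [] σ = 0 := rfl

theorem val_cons (e : BState × ℕ) (D : Weights) (σ : BState) :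
    val (e :: D) σ = (if e.1 = σ then e.2 else 0) + val D σ := by
  simp only [val, List.map_cons, List.sum_cons, Bool.cond_decide]

theorem val_append (D D' : Weights) (σ : BState) : val (D ++ D') σ = val D σ + val D' σ := by
  simp [val]

theorem val_flatMap {ι : Type} (l : List ι) (F : ι → Weights) (σ : BState) :
    val (l.flatMap F) σ = (l.map fun x => val (F x) σ).sum := by
  induction l with
  | nil => rfl
  | cons x l ih => rw [List.flatMap_cons, val_append, ih, List.map_cons, List.sum_cons]

theorem val_insert (e : BState × ℕ) (D : Weights) (σ : BState) :
    val (insert e D) σ = (if e.1 = σ then e.2 else 0) + val D σ := by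
  induction D with
  | nil => rw [insert, val_cons]
  | cons e' D ih =>
    rw [insert, Bool.cond_decide]
    split
    · next he =>
      simp only [val_cons, he]
      split <;> ring
    · rw [val_cons, ih, val_cons]
      ring

theorem val_merge (D : Weights) (σ : BState) : val (merge D) σ = val D σ := by
  induction D with
  | nil => rfl
  | cons e D ih => rw [merge, val_insert, ih, val_cons]

theorem val_eq_zero {D : Weights} {σ : BState} (hσ : σ ∉ D.map Prod.fst) : val D σ = 0 := by
  induction D with
  | nil => rfl
  | cons e D ih =>
    rw [List.map_cons, List.mem_cons, not_or] at hσ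
    rw [val_cons, ih hσ.2, if_neg (Ne.symm hσ.1)]

/-- pairing of weights with a function on the states -/
theorem sum_val_mul (D : Weights) (L : Finset BState) (hL : ∀ e ∈ D, e.1 ∈ L) (φ : BState → ℕ) :
    ∑ σ ∈ L, val D σ * φ σ = (D.map fun e => e.2 * φ e.1).sum := by
  induction D with
  | nil => simp [val_nil]
  | cons e D ih =>
    rw [List.map_cons, List.sum_cons, ← ih fun e he => hL e (List.mem_cons_of_mem _ he)]
    simp only [val_cons, add_mul, Finset.sum_add_distrib, ite_mul, zero_mul]
    rw [Finset.sum_ite_eq, if_pos (hL e List.mem_cons_self)]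

/-- a decision procedure for the equality of two weight functions up to a scalar -/
def equal (k : ℕ) (D D' : Weights) : Bool :=
  (D ++ D').all fun e => Nat.beq (D.val e.1) (k * D'.val e.1)

theorem val_eq_of_equal {k : ℕ} {D D' : Weights} (hD : equal k D D' = true) (σ : BState) :
    val D σ = k * val D' σ := by
  by_cases hσ : σ ∈ (D ++ D').map Prod.fst
  · obtain ⟨e, he, rfl⟩ := List.mem_map.1 hσ
    exact Nat.eq_of_beq_eq_true (List.all_eq_true.1 hD e he)
  · rw [List.map_append, List.mem_append, not_or] at hσ
    rw [val_eq_zero hσ.1, val_eq_zero hσ.2, mul_zero]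

end Weights

theorem val_glueWeights (J : Fin 6 → Bool) (D : Fin 3 → Weights) (τ : BState) :
    (glueWeights J D).val τ = ((D 0).map fun x => ((D 1).map fun y => ((D 2).map fun z =>
      if glueOk J (triple x.1 y.1 z.1) = true ∧ glueState J (triple x.1 y.1 z.1) = τ then
        x.2 * y.2 * z.2 else 0).sum).sum).sum := by
  simp only [glueWeights, Weights.val_merge, Weights.val_flatMap]
  refine congrArg List.sum (List.map_congr_left fun x _ => congrArg List.sum
    (List.map_congr_left fun y _ => congrArg List.sum (List.map_congr_left fun z _ => ?_)))
  by_cases h1 : glueOk J (triple x.1 y.1 z.1) = true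
  · simp [h1, Weights.val_cons, Weights.val_nil]
  · simp [h1, Weights.val_nil]

theorem sum_piFinset_triple {β : Type} [DecidableEq β] (L : Fin 3 → Finset β)
    (φ : (Fin 3 → β) → ℕ) :
    ∑ σ ∈ Fintype.piFinset L, φ σ = ∑ x ∈ L 0, ∑ y ∈ L 1, ∑ z ∈ L 2, φ (triple x y z) := by
  simp only [← Finset.sum_product']
  refine Finset.sum_nbij' (fun σ => (σ 0, σ 1, σ 2)) (fun x => triple x.1 x.2.1 x.2.2)
    ?_ ?_ ?_ ?_ ?_
  · intro σ hσ
    rw [Fintype.mem_piFinset] at hσ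
    simp [hσ]
  · intro x hx
    simp only [Finset.mem_product] at hx
    rw [Fintype.mem_piFinset]
    intro i
    fin_cases i
    exacts [hx.1, hx.2.1, hx.2.2]
  · exact fun σ _ => triple_eta σ
  · exact fun x _ => rfl
  · exact fun σ _ => by rw [triple_eta]

theorem Gluing.count_eq_glueWeights {α : Type*} {g : Gadget α} {h : Fin 3 → Gadget α}
    (H : Gluing g h) {X : Set α} {J : Fin 6 → Bool} (hJ : ∀ s, J s = true ↔ nodeVertex h s ∈ X)
    (hX : ∀ k, g.corner k ∉ X) (D : Fin 3 → Weights) (k : Fin 3 → ℕ)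
    (hD : ∀ i σ, count (h i) X σ = k i * (D i).val σ) (τ : BState) :
    count g X τ = k 0 * k 1 * k 2 * (glueWeights J D).val τ := by
  have hmem : ∀ i, ∀ e ∈ D i, e.1 ∈ ((D i).map Prod.fst).toFinset := fun i e he =>
    List.mem_toFinset.2 (List.mem_map_of_mem he)
  rw [H.count_eq hJ hX (fun i => ((D i).map Prod.fst).toFinset) _ τ, sum_piFinset_triple,
    val_glueWeights]
  · calc _ = ∑ x ∈ ((D 0).map Prod.fst).toFinset, (D 0).val x * ∑ y ∈ ((D 1).map Prod.fst).toFinset,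
          (D 1).val y * ∑ z ∈ ((D 2).map Prod.fst).toFinset, (D 2).val z *
            (if glueOk J (triple x y z) = true ∧ glueState J (triple x y z) = τ then
              k 0 * k 1 * k 2 else 0) := by
          simp only [Finset.mul_sum]
          refine Finset.sum_congr rfl fun x _ => Finset.sum_congr rfl fun y _ =>
            Finset.sum_congr rfl fun z _ => ?_
          split
          · rw [Fin.prod_univ_three, hD, hD, hD]
            simp only [triple]
            ring
          · simp
      _ = _ := by
          rw [Weights.sum_val_mul _ _ (hmem 0)]
          simp only [Weights.sum_val_mul _ _ (hmem 2)]
          simp only [Weights.sum_val_mul _ _ (hmem 1)]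
          simp only [← List.sum_map_mul_left]
          refine congrArg List.sum (List.map_congr_left fun x _ => congrArg List.sum
            (List.map_congr_left fun y _ => congrArg List.sum (List.map_congr_left fun z _ => ?_)))
          split
          · ring
          · simp
  · intro i σ hσ
    rw [hD] at hσ
    by_contra hcon
    rw [List.mem_toFinset] at hcon
    rw [Weights.val_eq_zero hcon, mul_zero] at hσ
    exact hσ rfl

/-! ### Transport of counts -/

section Transport

variable {α : Type*}

theorem IsCover.congr {g : Gadget α} {X Y : Set α}
    (hXY : ∀ v ∈ g.verts, v ∉ Set.range g.corner → (v ∈ X ↔ v ∈ Y)) {S : Finset (Sym2 α)}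
    (hS : IsCover g X S) : IsCover g Y S := by
  refine ⟨hS.1, hS.2.1, fun v hv hvc => ?_, hS.2.2.2⟩
  rw [hS.2.2.1 v hv hvc, if_congr (hXY v hv hvc) rfl rfl]

theorem marked_congr {g : Gadget α} {X Y : Set α}
    (hXY : ∀ v ∈ g.verts, v ∉ Set.range g.corner → (v ∈ X ↔ v ∈ Y)) (S : Finset (Sym2 α)) :
    Marked g X S = Marked g Y S := by
  funext v
  rw [Marked, Marked, eq_iff_iff]
  refine exists_congr fun x => and_congr_right fun hx => and_congr_right fun hxc => ?_
  rw [hXY x hx hxc]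

/-- Only the marked vertices other than the corners matter. -/
theorem count_congr {g : Gadget α} {X Y : Set α}
    (hXY : ∀ v ∈ g.verts, v ∉ Set.range g.corner → (v ∈ X ↔ v ∈ Y)) (σ : BState) :
    count g X σ = count g Y σ := by
  have h1 : ∀ S, IsCover g X S ↔ IsCover g Y S := fun S =>
    ⟨fun hS => hS.congr hXY, fun hS => hS.congr fun v hv hvc => (hXY v hv hvc).symm⟩
  have h2 : ∀ S, state g X S = state g Y S := fun S => by
    simp only [state, marked_congr hXY]
  rw [count, count, Finset.filter_congr fun S _ => by rw [h1, h2]]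

/-- the image of a graph under a bijection -/
def Gadget.map (g : Gadget α) (e : α ≃ α) : Gadget α where
  verts := e '' g.verts
  edges := g.edges.map ⟨Sym2.map e, Sym2.map.injective e.injective⟩
  corner i := e (g.corner i)
  mem_verts := by
    simp only [Finset.mem_map, Function.Embedding.coeFn_mk]
    rintro _ ⟨s, hs, rfl⟩ v hv
    obtain ⟨w, hw, rfl⟩ := Sym2.mem_map.1 hv
    exact ⟨w, g.mem_verts s hs w hw, rfl⟩
  not_isDiag := by
    simp only [Finset.mem_map, Function.Embedding.coeFn_mk]
    rintro _ ⟨s, hs, rfl⟩ hd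
    refine g.not_isDiag s hs ?_
    induction s with
    | h u v => simpa using hd
  corner_mem i := ⟨_, g.corner_mem i, rfl⟩
  corner_injective := e.injective.comp g.corner_injective

theorem deg_map (e : α ≃ α) (S : Finset (Sym2 α)) (v : α) :
    deg (S.map ⟨Sym2.map e, Sym2.map.injective e.injective⟩) (e v) = deg S v := by
  rw [deg, Finset.filter_map, Finset.card_map, deg]
  congr 2
  funext s
  induction s with
  | h u w => simp

theorem conn_map (e : α ≃ α) (S : Finset (Sym2 α)) (u v : α) :
    Conn (S.map ⟨Sym2.map e, Sym2.map.injective e.injective⟩) (e u) (e v) ↔ Conn S u v := by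
  have hmem : ∀ u v, s(e u, e v) ∈ S.map ⟨Sym2.map e, Sym2.map.injective e.injective⟩ ↔
      s(u, v) ∈ S := fun u v => Finset.mem_map' (a := s(u, v)) ⟨_, Sym2.map.injective e.injective⟩
  constructor
  · intro hc
    generalize he : e v = w at hc
    induction hc generalizing v with
    | refl =>
      rw [e.injective he]
      exact .refl
    | @tail w w' _ hww' ih =>
      subst he
      obtain ⟨w, rfl⟩ := e.surjective w
      exact (ih w rfl).tail ((hmem _ _).1 hww')
  · intro hc
    induction hc with
    | refl => exact .refl
    | tail _ hww' ih => exact ih.tail ((hmem _ _).2 hww')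

theorem isCover_map (g : Gadget α) (e : α ≃ α) (X : Set α) (S : Finset (Sym2 α)) :
    IsCover (g.map e) X (S.map ⟨Sym2.map e, Sym2.map.injective e.injective⟩) ↔
      IsCover g (e ⁻¹' X) S := by
  simp only [IsCover, Gadget.map, Finset.map_subset_map, deg_map, Set.forall_mem_image,
    Set.exists_mem_image, conn_map, Set.mem_preimage, Set.mem_range, EmbeddingLike.apply_eq_iff_eq]

theorem marked_map (g : Gadget α) (e : α ≃ α) (X : Set α) (S : Finset (Sym2 α)) (v : α) :
    Marked (g.map e) X (S.map ⟨Sym2.map e, Sym2.map.injective e.injective⟩) (e v) ↔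
      Marked g (e ⁻¹' X) S v := by
  simp only [Marked, Gadget.map, Set.exists_mem_image, conn_map, Set.mem_preimage, Set.mem_range,
    EmbeddingLike.apply_eq_iff_eq]

theorem count_map (g : Gadget α) (e : α ≃ α) (X : Set α) (σ : BState) :
    count (g.map e) X σ = count g (e ⁻¹' X) σ := by
  symm
  have hst : ∀ S : Finset (Sym2 α), state (g.map e) X
      (S.map ⟨Sym2.map e, Sym2.map.injective e.injective⟩) = state g (e ⁻¹' X) S := fun S => by
    have hc : ∀ i, (g.map e).corner i = e (g.corner i) := fun _ => rfl
    simp only [state, hc, deg_map, conn_map, marked_map]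
  refine Finset.card_nbij (fun S => S.map ⟨Sym2.map e, Sym2.map.injective e.injective⟩) ?_ ?_ ?_
  · intro S hS
    rw [Finset.mem_coe, Finset.mem_filter, Finset.mem_powerset] at hS ⊢
    rw [isCover_map, hst]
    exact ⟨Finset.map_subset_map.2 hS.1, hS.2⟩
  · exact (Finset.map_injective _).injOn
  · intro T hT
    rw [Finset.mem_coe, Finset.mem_filter, Finset.mem_powerset] at hT
    obtain ⟨S, hS, rfl⟩ := Finset.subset_map_iff.1 hT.1
    rw [isCover_map, hst] at hT
    exact ⟨S, by rw [Finset.mem_coe, Finset.mem_filter, Finset.mem_powerset]; exact ⟨hS, hT.2⟩, rfl⟩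

end Transport

namespace Gluing

variable {α : Type*} {g : Gadget α} {h : Fin 3 → Gadget α} (H : Gluing g h)

include H

theorem nodeVertex_injective : Function.Injective (nodeVertex h) := by
  intro s t hst
  obtain ⟨i, k, rfl⟩ := exists_node s
  obtain ⟨j, l, rfl⟩ := exists_node t
  rw [H.nodeVertex_node, H.nodeVertex_node] at hst
  by_cases hij : i = j
  · subst hij
    rw [(h i).corner_injective hst]
  · have h1 := H.inter i j hij _ ((h i).corner_mem k) (hst ▸ (h j).corner_mem l)
    have h2 := (h i).corner_injective h1
    subst h2
    rw [H.symm i k] at hst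
    rw [← (h k).corner_injective hst, node_symm]

/-- Marking a node does not affect the pieces. -/
theorem count_piece_node (i j k : Fin 3) (σ : BState) :
    count (h i) {(h j).corner k} σ = count (h i) ∅ σ := by
  refine count_congr (fun v hv hvc => ?_) σ
  simp only [Set.mem_singleton_iff, Set.mem_empty_iff_false, iff_false]
  rintro rfl
  rw [← H.nodeVertex_node] at hv
  obtain ⟨l, hl⟩ := H.nodeVertex_mem hv
  rw [← H.nodeVertex_node, ← hl, H.nodeVertex_node] at hvc
  exact hvc ⟨l, rfl⟩

/-- Marking a vertex of a piece does not affect the other pieces. -/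
theorem count_piece_of_ne {i j : Fin 3} (hij : i ≠ j) {x : α} (hx : x ∈ (h i).verts) (σ : BState) :
    count (h j) {x} σ = count (h j) ∅ σ := by
  refine count_congr (fun v hv hvc => ?_) σ
  simp only [Set.mem_singleton_iff, Set.mem_empty_iff_false, iff_false]
  rintro rfl
  exact hvc ⟨i, (H.inter j i hij.symm v hv hx).symm⟩

theorem nodeVertex_ne {i : Fin 3} {x : α} (hx : x ∈ (h i).verts)
    (hxc : x ∉ Set.range (h i).corner) (s : Fin 6) : nodeVertex h s ≠ x := by
  rintro rfl
  obtain ⟨l, rfl⟩ := H.nodeVertex_mem hx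
  exact hxc ⟨l, (H.nodeVertex_node i l).symm⟩

end Gluing

/-! ### The Sierpinski gasket graphs -/

theorem sq3_pos : 0 < sq3 := Real.sqrt_pos.2 (by norm_num)

/-- the outmost vertices of `SG n` -/
def outer (n : ℕ) : Fin 3 → ℝ × ℝ
  | 0 => o
  | 1 => a n
  | 2 => b n

theorem outer_succ (n : ℕ) (k : Fin 3) : outer (n + 1) k = outer n k + outer n k := by
  fin_cases k <;> ext <;> simp [outer, o, a, b] <;> ring

theorem outer_injective (n : ℕ) : Function.Injective (outer n) := by
  have h2 : (0 : ℝ) < 2 ^ n := by positivity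
  intro i j hij
  have h1 := congrArg Prod.fst hij
  fin_cases i <;> fin_cases j <;> simp [outer, o, a, b] at h1 ⊢ <;> linarith

theorem mem_V_succ (n : ℕ) (v : ℝ × ℝ) : v ∈ V (n + 1) ↔ ∃ i, ∃ w ∈ V n, w + outer n i = v := by
  have h0 : (0 : ℝ × ℝ) = o := rfl
  rw [V, Set.mem_union, Set.mem_union, Fin.exists_fin_succ, Fin.exists_fin_two, ← or_assoc]
  simp only [Set.mem_image, outer, ← h0, add_zero, exists_eq_right, Fin.succ_zero_eq_one,
    Fin.succ_one_eq_two]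

theorem mem_E_succ (n : ℕ) (e : Sym2 (ℝ × ℝ)) :
    e ∈ E (n + 1) ↔ ∃ i, ∃ e' ∈ E n, e'.map (· + outer n i) = e := by
  have h0 : (0 : ℝ × ℝ) = o := rfl
  have h1 : ∀ e' : Sym2 (ℝ × ℝ), e'.map (· + o) = e' := fun e' => by
    rw [← h0]
    simp
  rw [E, Set.mem_union, Set.mem_union, Fin.exists_fin_succ, Fin.exists_fin_two, ← or_assoc]
  simp [outer, h1]

theorem finite_E (n : ℕ) : (E n).Finite := by
  induction n with
  | zero => exact ((Set.finite_singleton _).insert _).insert _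
  | succ n ih => exact (ih.union (ih.image _)).union (ih.image _)

theorem outer_mem (n : ℕ) (k : Fin 3) : outer n k ∈ V n := by
  induction n with
  | zero => fin_cases k <;> simp [outer, V]
  | succ n ih => exact (mem_V_succ _ _).2 ⟨k, _, ih, (outer_succ n k).symm⟩

theorem mem_V_of_mem_E (n : ℕ) : ∀ e ∈ E n, ∀ v ∈ e, v ∈ V n := by
  induction n with
  | zero =>
    intro e he v hv
    simp only [E, Set.mem_insert_iff, Set.mem_singleton_iff] at he
    rcases he with rfl | rfl | rfl <;> rw [Sym2.mem_iff] at hv <;> rcases hv with rfl | rfl <;>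
      simp [V]
  | succ n ih =>
    intro e he v hv
    obtain ⟨i, e', he', rfl⟩ := (mem_E_succ _ _).1 he
    obtain ⟨w, hw, rfl⟩ := Sym2.mem_map.1 hv
    exact (mem_V_succ _ _).2 ⟨i, w, ih e' he' w hw, rfl⟩

theorem not_isDiag_of_mem_E (n : ℕ) : ∀ e ∈ E n, ¬ e.IsDiag := by
  induction n with
  | zero =>
    intro e he
    simp only [E, Set.mem_insert_iff, Set.mem_singleton_iff] at he
    have h01 : o ≠ a 0 := (outer_injective 0).ne (a₁ := 0) (a₂ := 1) (by decide)
    have h02 : o ≠ b 0 := (outer_injective 0).ne (a₁ := 0) (a₂ := 2) (by decide)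
    have h12 : a 0 ≠ b 0 := (outer_injective 0).ne (a₁ := 1) (a₂ := 2) (by decide)
    rcases he with rfl | rfl | rfl <;> simpa
  | succ n ih =>
    intro e he hd
    obtain ⟨i, e', he', rfl⟩ := (mem_E_succ _ _).1 he
    refine ih e' he' ?_
    induction e' with
    | h u v => simpa using hd

/-- `SG n` with its outmost vertices as corners -/
def gasket (n : ℕ) : Gadget (ℝ × ℝ) where
  verts := V n
  edges := (finite_E n).toFinset
  corner := outer n
  mem_verts e he := mem_V_of_mem_E n e ((finite_E n).mem_toFinset.1 he)
  not_isDiag e he := not_isDiag_of_mem_E n e ((finite_E n).mem_toFinset.1 he)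
  corner_mem := outer_mem n
  corner_injective := outer_injective n

/-- the three copies of `SG n` in `SG (n + 1)` -/
def piece (n : ℕ) (i : Fin 3) : Gadget (ℝ × ℝ) := (gasket n).map (Equiv.addRight (outer n i))

theorem triangle (n : ℕ) : ∀ v ∈ V n,
    0 ≤ v.2 ∧ v.2 ≤ v.1 * sq3 ∧ v.2 ≤ (2 ^ n - v.1) * sq3 := by
  have h3 := sq3_pos
  induction n with
  | zero =>
    intro v hv
    simp only [V, Set.mem_insert_iff, Set.mem_singleton_iff] at hv
    rcases hv with rfl | rfl | rfl <;> simp [o, a, b, h3.le]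
    nlinarith
  | succ n ih =>
    have h2 : (0 : ℝ) < 2 ^ n * sq3 := by positivity
    intro v hv
    obtain ⟨i, w, hw, rfl⟩ := (mem_V_succ _ _).1 hv
    obtain ⟨h4, h5, h6⟩ := ih w hw
    fin_cases i <;> simp [outer, o, a, b, pow_succ] <;> refine ⟨?_, ?_, ?_⟩ <;> nlinarith

theorem inter_aux {n : ℕ} {i j : Fin 3} (hij : i < j) {v w : ℝ × ℝ} (hv : v ∈ V n) (hw : w ∈ V n)
    (hvw : v + outer n i = w + outer n j) : v = outer n j := by
  have h3 := sq3_pos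
  obtain ⟨h4, h5, h6⟩ := triangle n v hv
  obtain ⟨h4', h5', h6'⟩ := triangle n w hw
  obtain ⟨v1, v2⟩ := v
  obtain ⟨w1, w2⟩ := w
  rw [Prod.ext_iff] at hvw
  have key : ∀ {x y : ℝ}, x * sq3 ≤ y * sq3 → x ≤ y := fun h => le_of_mul_le_mul_right h h3
  fin_cases i <;> fin_cases j <;> simp [outer, o, a, b] at hvw hij ⊢ h4 h5 h6 h4' h5' h6' <;>
    obtain ⟨hx, hy⟩ := hvw
  · have : v1 = 2 ^ n := le_antisymm (key (by nlinarith)) (key (by nlinarith))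
    subst this
    exact ⟨rfl, by nlinarith⟩
  · have : v1 = 2 ^ n / 2 := le_antisymm (key (by nlinarith)) (key (by nlinarith))
    subst this
    exact ⟨rfl, by nlinarith⟩
  · have : v1 = 2 ^ n / 2 := le_antisymm (key (by nlinarith)) (key (by nlinarith))
    subst this
    exact ⟨rfl, by nlinarith⟩

theorem gluing_gasket (n : ℕ) : Gluing (gasket (n + 1)) (piece n) where
  verts v := mem_V_succ n v
  edges e := by
    have h1 : ∀ k e, e ∈ (gasket k).edges ↔ e ∈ E k := fun k e => (finite_E k).mem_toFinset
    simp only [piece, Gadget.map, Finset.mem_map, h1, Function.Embedding.coeFn_mk]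
    exact mem_E_succ n e
  corner k := outer_succ n k
  symm i j := add_comm _ _
  inter i j hij v := by
    rintro ⟨v, hv, rfl⟩ ⟨w, hw, hvw⟩
    change w + outer n j = v + outer n i at hvw
    change v + outer n i = outer n j + outer n i
    rcases lt_or_gt_of_ne hij with hlt | hlt
    · rw [inter_aux hlt hv hw hvw.symm]
    · rw [← hvw, inter_aux hlt hw hv hvw, add_comm]

theorem piece_corner (n : ℕ) (i k : Fin 3) : (piece n i).corner k = outer n k + outer n i := rfl

theorem mem_piece {n : ℕ} {i : Fin 3} {y : ℝ × ℝ} (hy : y ∈ V n) :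
    outer n i + y ∈ (piece n i).verts :=
  ⟨y, hy, add_comm _ _⟩

theorem not_mem_piece_corner {n : ℕ} {i : Fin 3} {y : ℝ × ℝ} (hy : y ∉ Set.range (outer n)) :
    outer n i + y ∉ Set.range (piece n i).corner := by
  rintro ⟨k, hk⟩
  rw [piece_corner, add_comm] at hk
  exact hy ⟨k, add_left_cancel hk⟩

theorem mem_V_succ_of_mem {n : ℕ} {i : Fin 3} {y : ℝ × ℝ} (hy : y ∈ V n) :
    outer n i + y ∈ V (n + 1) :=
  ((gluing_gasket n).verts _).2 ⟨i, mem_piece hy⟩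

theorem not_mem_range_outer_succ {n : ℕ} {i : Fin 3} {y : ℝ × ℝ} (hy : y ∈ V n)
    (hyc : y ∉ Set.range (outer n)) : outer n i + y ∉ Set.range (outer (n + 1)) :=
  (gluing_gasket n).not_corner (mem_piece hy) (not_mem_piece_corner hyc)

theorem junction_mem {n : ℕ} {i j : Fin 3} : outer n i + outer n j ∈ V (n + 1) :=
  mem_V_succ_of_mem (outer_mem n j)

theorem junction_not_mem_range_outer {n : ℕ} {i j : Fin 3} (hij : i ≠ j) :
    outer n i + outer n j ∉ Set.range (outer (n + 1)) := by
  rw [add_comm (outer n i)]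
  exact (gluing_gasket n).junction_not_corner hij

theorem count_piece (n : ℕ) (i : Fin 3) (σ : BState) :
    count (piece n i) ∅ σ = count (gasket n) ∅ σ := by
  rw [piece, count_map, Set.preimage_empty]

theorem count_piece_singleton (n : ℕ) (i : Fin 3) (y : ℝ × ℝ) (σ : BState) :
    count (piece n i) {outer n i + y} σ = count (gasket n) {y} σ := by
  rw [piece, count_map]
  congr 1
  ext v
  simp [add_comm]

/-- the indicator of at most one node -/
def atNode : Option (Fin 6) → Fin 6 → Bool
  | none, _ => false
  | some s, t => decide (t = s)

theorem count_gasket_succ {n k : ℕ} {D : Weights} (hD : ∀ σ, count (gasket n) ∅ σ = k * D.val σ)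
    (τ : BState) :
    count (gasket (n + 1)) ∅ τ = k ^ 3 * (glueWeights (atNode none) fun _ => D).val τ := by
  rw [(gluing_gasket n).count_eq_glueWeights (J := atNode none) (by simp [atNode]) (by simp)
    (fun _ => D) (fun _ => k) (fun i σ => (count_piece n i σ).trans (hD σ))]
  ring

theorem count_gasket_junction {n k : ℕ} {D : Weights}
    (hD : ∀ σ, count (gasket n) ∅ σ = k * D.val σ) {i j : Fin 3} (hij : i ≠ j) (τ : BState) :
    count (gasket (n + 1)) {outer n i + outer n j} τ =
      k ^ 3 * (glueWeights (atNode (some (node i j))) fun _ => D).val τ := by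
  have H := gluing_gasket n
  have hx : outer n i + outer n j = (piece n i).corner j := by rw [piece_corner, add_comm]
  rw [H.count_eq_glueWeights (J := atNode (some (node i j))) _ _ (fun _ => D) (fun _ => k) _]
  · ring
  · intro s
    rw [atNode, decide_eq_true_iff, hx, ← H.nodeVertex_node, Set.mem_singleton_iff,
      H.nodeVertex_injective.eq_iff]
  · intro l hl
    exact junction_not_mem_range_outer hij ⟨l, hl⟩
  · intro l σ
    rw [hx, H.count_piece_node, count_piece, hD]

theorem count_gasket_piece {n k k' : ℕ} {D D' : Weights}
    (hD : ∀ σ, count (gasket n) ∅ σ = k * D.val σ) {y : ℝ × ℝ} (hy : y ∈ V n)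
    (hyc : y ∉ Set.range (outer n)) (hD' : ∀ σ, count (gasket n) {y} σ = k' * D'.val σ) (i : Fin 3)
    (τ : BState) :
    count (gasket (n + 1)) {outer n i + y} τ =
      k' * k ^ 2 * (glueWeights (atNode none) fun j =>
        bif decide (j = i) then D' else D).val τ := by
  have H := gluing_gasket n
  rw [H.count_eq_glueWeights (J := atNode none) _ _ (fun j => bif decide (j = i) then D' else D)
    (fun j => bif decide (j = i) then k' else k) _]
  · congr 1
    fin_cases i <;> simp <;> ring
  · intro s
    simp only [atNode, Bool.false_eq_true, Set.mem_singleton_iff, false_iff]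
    exact H.nodeVertex_ne (mem_piece hy) (not_mem_piece_corner hyc) s
  · intro l hl
    exact not_mem_range_outer_succ hy hyc ⟨l, hl⟩
  · intro j σ
    by_cases hj : j = i
    · subst hj
      simp only [decide_true, cond_true]
      rw [count_piece_singleton, hD']
    · simp only [hj, decide_false, cond_false]
      rw [H.count_piece_of_ne (Ne.symm hj) (mem_piece hy), count_piece, hD]

/-! ### Triangles -/

section TriangleGraph

variable {α : Type*} {p q r : α} {S : Finset (Sym2 α)}

theorem conn_triangle (hpq : p ≠ q) (hpr : p ≠ r) (hqr : q ≠ r)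
    (hS : ∀ e ∈ S, e = s(p, q) ∨ e = s(p, r) ∨ e = s(q, r)) :
    Conn S p q ↔ s(p, q) ∈ S ∨ s(p, r) ∈ S ∧ s(q, r) ∈ S := by
  constructor
  · intro hc
    have key : ∀ w, Conn S p w → w = p ∨ w = q ∧ (s(p, q) ∈ S ∨ s(p, r) ∈ S ∧ s(q, r) ∈ S) ∨
        w = r ∧ (s(p, r) ∈ S ∨ s(p, q) ∈ S ∧ s(q, r) ∈ S) := by
      intro w hw
      induction hw with
      | refl => exact .inl rfl
      | @tail w w' _ hww' ih =>
        have := hS _ hww'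
        simp only [Sym2.eq_iff] at this
        rcases this with (⟨rfl, rfl⟩ | ⟨rfl, rfl⟩) | (⟨rfl, rfl⟩ | ⟨rfl, rfl⟩) |
          (⟨rfl, rfl⟩ | ⟨rfl, rfl⟩) <;> simp_all [Sym2.eq_swap] <;> tauto
    rcases key q hc with h | h | h
    · exact absurd h.symm hpq
    · exact h.2
    · exact absurd h.1 hqr
  · rintro (h | ⟨h, h'⟩)
    · exact .single h
    · exact .tail (.single h) (by rwa [Sym2.eq_swap])

theorem deg_triangle (hpq : p ≠ q) (hpr : p ≠ r) (hqr : q ≠ r)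
    (hS : ∀ e ∈ S, e = s(p, q) ∨ e = s(p, r) ∨ e = s(q, r)) :
    deg S p = (if s(p, q) ∈ S then 1 else 0) + if s(p, r) ∈ S then 1 else 0 := by
  have h1 : S.filter (p ∈ ·) = ({s(p, q), s(p, r)} : Finset (Sym2 α)).filter (· ∈ S) := by
    ext e
    simp only [Finset.mem_filter, Finset.mem_insert, Finset.mem_singleton]
    constructor
    · rintro ⟨he, hpe⟩
      rcases hS e he with rfl | rfl | rfl
      · exact ⟨.inl rfl, he⟩
      · exact ⟨.inr rfl, he⟩
      · simp [hpq, hpr] at hpe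
    · rintro ⟨rfl | rfl, he⟩ <;> simp [he]
  rw [deg, h1, Finset.card_filter, Finset.sum_pair]
  simp [hqr, hpr]

/-- the state of a set of edges of a triangle, given by the edges opposite to the corners -/
def triangleState (b0 b1 b2 : Bool) : BState where
  d0 := b2.toNat + b1.toNat
  d1 := b2.toNat + b0.toNat
  d2 := b1.toNat + b0.toNat
  c01 := b2 || (b1 && b0)
  c02 := b1 || (b2 && b0)
  c12 := b0 || (b2 && b1)
  m0 := false
  m1 := false
  m2 := false

/-- the weights of a triangle -/
def triangleWeights : Weights :=
  [(triangleState false false false, 1), (triangleState true false false, 1),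
    (triangleState false true false, 1), (triangleState false false true, 1),
    (triangleState true true false, 1), (triangleState true false true, 1),
    (triangleState false true true, 1)]

theorem count_triangle (g : Gadget α) (hv : ∀ v ∈ g.verts, v ∈ Set.range g.corner)
    (he : ∀ e, e ∈ g.edges ↔ e = s(g.corner 0, g.corner 1) ∨ e = s(g.corner 0, g.corner 2) ∨
      e = s(g.corner 1, g.corner 2)) (σ : BState) :
    count g ∅ σ = triangleWeights.val σ := by
  have h01 := g.corner_injective.ne (a₁ := 0) (a₂ := 1) (by decide)
  have h02 := g.corner_injective.ne (a₁ := 0) (a₂ := 2) (by decide)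
  have h12 := g.corner_injective.ne (a₁ := 1) (a₂ := 2) (by decide)
  set p := g.corner 0 with hp
  set q := g.corner 1 with hq
  set r := g.corner 2 with hr
  have main : ∀ S ⊆ g.edges, (IsCover g ∅ S ↔ ¬ (s(q, r) ∈ S ∧ s(p, r) ∈ S ∧ s(p, q) ∈ S)) ∧
      state g ∅ S = triangleState (decide (s(q, r) ∈ S)) (decide (s(p, r) ∈ S))
        (decide (s(p, q) ∈ S)) := by
    intro S hSg
    have hS : ∀ e ∈ S, e = s(p, q) ∨ e = s(p, r) ∨ e = s(q, r) := fun e h => (he e).1 (hSg h)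
    have d0 := deg_triangle h01 h02 h12 hS
    have d1 := deg_triangle (S := S) h01.symm h12 h02 (by grind [Sym2.eq_swap])
    have d2 := deg_triangle (S := S) h02.symm h12.symm h01 (by grind [Sym2.eq_swap])
    have c01 := conn_triangle h01 h02 h12 hS
    have c02 := conn_triangle (S := S) h02 h01 h12.symm (by grind [Sym2.eq_swap])
    have c12 := conn_triangle (S := S) h12 h01.symm h02.symm (by grind [Sym2.eq_swap])
    have c10 : Conn S q p ↔ Conn S p q := ⟨Conn.symm, Conn.symm⟩
    have c20 : Conn S r p ↔ Conn S p r := ⟨Conn.symm, Conn.symm⟩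
    have c21 : Conn S r q ↔ Conn S q r := ⟨Conn.symm, Conn.symm⟩
    have c00 : ∀ v, Conn S v v := fun v => .refl
    have e1 : s(q, p) = s(p, q) := Sym2.eq_swap
    have e2 : s(r, p) = s(p, r) := Sym2.eq_swap
    have e3 : s(r, q) = s(q, r) := Sym2.eq_swap
    rw [e1] at d1 c12
    rw [e2, e3] at d2
    rw [e3] at c02
    rw [e2] at c12
    have hm : ∀ v, ¬ Marked g ∅ S v := by
      rintro v ⟨x, -, -, hx, -⟩
      exact hx
    refine ⟨?_, ?_⟩
    · have h1 : IsCover g ∅ S ↔ (∀ i, deg S (g.corner i) ≤ 2) ∧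
          ∀ i, ∃ j, deg S (g.corner j) ≤ 1 ∧ Conn S (g.corner i) (g.corner j) := by
        constructor
        · rintro ⟨-, hC, -, hC'⟩
          refine ⟨hC, fun i => ?_⟩
          obtain ⟨w, hw, hw'⟩ := hC' _ (g.corner_mem i)
          obtain ⟨j, rfl⟩ := hv w hw
          exact ⟨j, hw'⟩
        · rintro ⟨hC, hC'⟩
          refine ⟨hSg, hC, fun v hv' hvc => absurd (hv v hv') hvc, fun v hv' => ?_⟩
          obtain ⟨i, rfl⟩ := hv v hv'
          obtain ⟨j, hj⟩ := hC' i
          exact ⟨_, g.corner_mem j, hj⟩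
      rw [h1]
      simp only [Fin.forall_fin_succ, Fin.exists_fin_succ, Fin.succ_zero_eq_one,
        Fin.succ_one_eq_two, IsEmpty.forall_iff, IsEmpty.exists_iff, ← hp, ← hq, ← hr, d0, d1, d2,
        c10, c20, c21, c01, c02, c12, c00]
      by_cases m0 : s(q, r) ∈ S <;> by_cases m1 : s(p, r) ∈ S <;> by_cases m2 : s(p, q) ∈ S <;>
        simp [m0, m1, m2]
    · simp only [state, triangleState, ← hp, ← hq, ← hr, d0, d1, d2, c01, c02, c12, hm]
      by_cases m0 : s(q, r) ∈ S <;> by_cases m1 : s(p, r) ∈ S <;> by_cases m2 : s(p, q) ∈ S <;>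
        simp [m0, m1, m2]
  have e0 : s(q, r) ≠ s(p, r) := by simp [h01.symm, h02.symm]
  have e1 : s(q, r) ≠ s(p, q) := by simp [h01.symm, h02.symm]
  have e2 : s(p, r) ≠ s(p, q) := by simp [h12.symm, h02.symm]
  have hcard : count g ∅ σ = (Finset.univ.filter fun x : Bool × Bool × Bool =>
      x ≠ (true, true, true) ∧ triangleState x.1 x.2.1 x.2.2 = σ).card := by
    refine Finset.card_nbij' (fun S => (decide (s(q, r) ∈ S), decide (s(p, r) ∈ S),
      decide (s(p, q) ∈ S))) (fun x => g.edges.filter fun e => (e = s(q, r) → x.1 = true) ∧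
        (e = s(p, r) → x.2.1 = true) ∧ (e = s(p, q) → x.2.2 = true)) ?_ ?_ ?_ ?_
    · intro S hS
      simp only [Finset.coe_filter, Finset.mem_powerset, Set.mem_ofPred_eq] at hS
      obtain ⟨hSg, hC, hσ⟩ := hS
      rw [(main S hSg).1] at hC
      rw [(main S hSg).2] at hσ
      simp only [Finset.coe_filter, Finset.mem_univ, true_and, Set.mem_ofPred_eq]
      exact ⟨by simpa using hC, hσ⟩
    · rintro ⟨x0, x1, x2⟩ hx
      simp only [Finset.coe_filter, Finset.mem_univ, true_and, Set.mem_ofPred_eq] at hx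
      simp only [Finset.coe_filter, Finset.mem_powerset, Set.mem_ofPred_eq]
      have hsub := Finset.filter_subset (fun e => (e = s(q, r) → x0 = true) ∧
        (e = s(p, r) → x1 = true) ∧ (e = s(p, q) → x2 = true)) g.edges
      refine ⟨hsub, ?_⟩
      rw [(main _ hsub).1, (main _ hsub).2]
      simp only [Finset.mem_filter, he, e0, e1, e2, e0.symm, e1.symm, e2.symm]
      simpa using hx
    · intro S hS
      simp only [Finset.coe_filter, Finset.mem_powerset, Set.mem_ofPred_eq] at hS
      ext e
      simp only [Finset.mem_filter, decide_eq_true_eq]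
      constructor
      · rintro ⟨h1, h2, h3, h4⟩
        rcases (he e).1 h1 with h5 | h5 | h5
        exacts [h5 ▸ h4 h5, h5 ▸ h3 h5, h5 ▸ h2 h5]
      · intro h1
        exact ⟨hS.1 h1, fun h => h ▸ h1, fun h => h ▸ h1, fun h => h ▸ h1⟩
    · rintro ⟨x0, x1, x2⟩ hx
      simp only [Finset.mem_filter, he, e0, e1, e2, e0.symm, e1.symm, e2.symm]
      simp
  rw [hcard, Finset.card_filter]
  simp only [Fintype.sum_prod_type, Fintype.sum_bool]
  simp [triangleWeights, Weights.val_cons, Weights.val_nil]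
  ring

end TriangleGraph

theorem count_gasket_zero (σ : BState) : count (gasket 0) ∅ σ = triangleWeights.val σ := by
  refine count_triangle _ (fun v hv => ?_) (fun e => ?_) σ
  · simp only [gasket, V, Set.mem_insert_iff, Set.mem_singleton_iff] at hv
    rcases hv with rfl | rfl | rfl
    exacts [⟨0, rfl⟩, ⟨1, rfl⟩, ⟨2, rfl⟩]
  · simp [gasket, E, outer]

/-! ### Hamiltonian paths as sets of edges -/

section HamiltonianPath

variable {α : Type*} {Γ : SimpleGraph α}

theorem deg_insert {S : Finset (Sym2 α)} {u w : α} (he : s(u, w) ∉ S) (y : α) :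
    deg (insert s(u, w) S) y = deg S y + if y = u ∨ y = w then 1 else 0 := by
  rw [deg, Finset.filter_insert, deg]
  simp only [Sym2.mem_iff]
  split
  · rw [Finset.card_insert_of_notMem]
    exact fun h => he (Finset.mem_filter.1 h).1
  · rfl

theorem not_mem_edges_of_not_mem_support {u v x y : α} {q : Γ.Walk u v} (hx : x ∉ q.support) :
    s(x, y) ∉ q.edges :=
  fun h => hx (q.fst_mem_support_of_mem_edges h)

theorem deg_edges_of_isPath {u v : α} {q : Γ.Walk u v} (hq : q.IsPath) (y : α) :
    (deg q.edges.toFinset y + (if y = u then 1 else 0)) + (if y = v then 1 else 0) =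
      if y ∈ q.support then 2 else 0 := by
  induction q with
  | nil => simp [deg]; split <;> rfl
  | @cons u w v h q ih =>
    rw [SimpleGraph.Walk.cons_isPath_iff] at hq
    have huw := h.ne
    have huv : u ≠ v := fun huv => hq.2 (huv ▸ q.end_mem_support)
    have ih := ih hq.1
    rw [SimpleGraph.Walk.edges_cons, List.toFinset_cons, deg_insert
      (by rw [List.mem_toFinset]; exact not_mem_edges_of_not_mem_support hq.2)]
    simp only [SimpleGraph.Walk.support_cons, List.mem_cons]
    by_cases hyu : y = u
    · subst hyu
      rw [if_neg huw, if_neg huv, if_neg hq.2] at ih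
      simp only [true_or, if_true, if_neg huv]
      omega
    · simp only [hyu, false_or, if_false]
      omega

theorem conn_edges {u v : α} (q : Γ.Walk u v) {y : α} (hy : y ∈ q.support) :
    Conn q.edges.toFinset u y := by
  induction q with
  | nil =>
    rw [SimpleGraph.Walk.mem_support_nil_iff] at hy
    rw [hy]
    exact .refl
  | @cons u w v h q ih =>
    rw [SimpleGraph.Walk.support_cons, List.mem_cons] at hy
    rcases hy with rfl | hy
    · exact .refl
    · rw [SimpleGraph.Walk.edges_cons, List.toFinset_cons]
      exact Conn.trans (.single (Finset.mem_insert_self _ _))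
        ((ih hy).mono (Finset.subset_insert _ _))

theorem eq_of_edges_eq {u v : α} {q q' : Γ.Walk u v} (hq : q.IsPath) (hq' : q'.IsPath)
    (h : q.edges.toFinset = q'.edges.toFinset) : q = q' := by
  induction q with
  | nil => exact (SimpleGraph.Walk.eq_nil_iff_nil.2 (SimpleGraph.Walk.isPath_iff_nil.1 hq')).symm
  | @cons u w v hu q ih =>
    cases q' with
    | nil => exact SimpleGraph.Walk.eq_nil_iff_nil.2 (SimpleGraph.Walk.isPath_iff_nil.1 hq)
    | @cons _ w' _ hu' q' =>
      rw [SimpleGraph.Walk.cons_isPath_iff] at hq hq'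
      simp only [SimpleGraph.Walk.edges_cons, List.toFinset_cons] at h
      have hn : s(u, w) ∉ q.edges.toFinset := by
        rw [List.mem_toFinset]; exact not_mem_edges_of_not_mem_support hq.2
      have hn' : s(u, w) ∉ q'.edges.toFinset := by
        rw [List.mem_toFinset]; exact not_mem_edges_of_not_mem_support hq'.2
      have hw : s(u, w) ∈ insert s(u, w') q'.edges.toFinset := h ▸ Finset.mem_insert_self _ _
      rw [Finset.mem_insert, or_iff_left hn', Sym2.congr_right] at hw
      subst hw
      rw [ih hq.1 hq'.1]
      rw [← Finset.erase_insert hn, h, Finset.erase_insert hn']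

theorem exists_path_of_deg {S : Finset (Sym2 α)} (hS : ∀ e ∈ S, e ∈ Γ.edgeSet) {u v : α}
    (huv : u ≠ v) (hu : deg S u = 1) (hv : deg S v = 1)
    (h2 : ∀ w, w ≠ u → w ≠ v → deg S w = 0 ∨ deg S w = 2) :
    ∃ q : Γ.Walk u v, q.IsPath ∧ q.edges.toFinset ⊆ S := by
  induction hn : S.card generalizing S u with
  | zero =>
    rw [Finset.card_eq_zero] at hn
    subst hn
    simp [deg] at hu
  | succ n ih =>
    have h1 : (S.filter (u ∈ ·)).Nonempty := by
      rw [← Finset.card_pos, ← deg, hu]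
      exact one_pos
    obtain ⟨e, he⟩ := h1
    rw [Finset.mem_filter] at he
    obtain ⟨heS, heu⟩ := he
    obtain ⟨w, rfl⟩ := Sym2.mem_iff_exists.1 heu
    have hadj : Γ.Adj u w := (SimpleGraph.mem_edgeSet _).1 (hS _ heS)
    have hdeg : ∀ y, deg S y = deg (S.erase s(u, w)) y + if y = u ∨ y = w then 1 else 0 :=
      fun y => by rw [← deg_insert (Finset.notMem_erase _ _), Finset.insert_erase heS]
    by_cases hwv : w = v
    · subst hwv
      refine ⟨.cons hadj .nil, by simpa using huv, ?_⟩
      simpa using heS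
    · have hu' : deg (S.erase s(u, w)) u = 0 := by
        have := hdeg u
        rw [if_pos (.inl rfl)] at this
        omega
      have hw' := hdeg w
      rw [if_pos (.inr rfl)] at hw'
      obtain ⟨q, hq, hqS⟩ := ih (S := S.erase s(u, w)) (u := w)
        (fun e he => hS e (Finset.mem_of_mem_erase he)) hwv
        (by rcases h2 w hadj.ne' hwv with h | h <;> omega)
        (by rw [← hv, hdeg v, if_neg (by rintro (h | h); exacts [huv h.symm, hwv h.symm]),
          add_zero])
        (fun y hyw hyv => by
          by_cases hyu : y = u
          · exact .inl (hyu ▸ hu')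
          · have := hdeg y
            rw [if_neg (by simp [hyu, hyw]), add_zero] at this
            rw [← this]
            exact h2 y hyu hyv)
        (by rw [Finset.card_erase_of_mem heS, hn, Nat.add_sub_cancel])
      refine ⟨.cons hadj q, ?_, ?_⟩
      · rw [SimpleGraph.Walk.cons_isPath_iff]
        refine ⟨hq, fun hmem => ?_⟩
        have h3 := deg_edges_of_isPath hq u
        rw [if_pos hmem, if_neg hadj.ne, if_neg huv] at h3
        have h4 := deg_mono hqS u
        omega
      · rw [SimpleGraph.Walk.edges_cons, List.toFinset_cons]
        exact Finset.insert_subset heS (hqS.trans (Finset.erase_subset _ _))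

/-- the sets of edges of Hamiltonian paths between two vertices -/
def IsPathSet (W : Set α) (u v : α) (S : Finset (Sym2 α)) : Prop :=
  deg S u = 1 ∧ deg S v = 1 ∧ (∀ w ∈ W, w ≠ u → w ≠ v → deg S w = 2) ∧ ∀ w ∈ W, Conn S u w

theorem card_path_eq (g : Gadget α) (hΓ : ∀ e, e ∈ g.edges ↔ e ∈ Γ.edgeSet) {u v : α}
    (hu : u ∈ g.verts) (hv : v ∈ g.verts) (huv : u ≠ v) :
    Nat.card {q : Γ.Walk u v // q.IsPath ∧ ∀ x, x ∈ q.support ↔ x ∈ g.verts} =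
      (g.edges.powerset.filter (IsPathSet g.verts u v)).card := by
  have hmem : ∀ q : {q : Γ.Walk u v // q.IsPath ∧ ∀ x, x ∈ q.support ↔ x ∈ g.verts},
      q.1.edges.toFinset ∈ g.edges.powerset.filter (IsPathSet g.verts u v) := by
    rintro ⟨q, hq, hqV⟩
    rw [Finset.mem_filter, Finset.mem_powerset]
    have hd := deg_edges_of_isPath hq
    refine ⟨fun e he => (hΓ e).2 (q.edges_subset_edgeSet (List.mem_toFinset.1 he)), ?_, ?_, ?_, ?_⟩
    · have := hd u
      rw [if_pos rfl, if_neg huv, if_pos ((hqV u).2 hu)] at this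
      show deg q.edges.toFinset u = 1
      omega
    · have := hd v
      rw [if_pos rfl, if_neg huv.symm, if_pos ((hqV v).2 hv)] at this
      show deg q.edges.toFinset v = 1
      omega
    · intro w hw hwu hwv
      have := hd w
      rwa [if_neg hwv, if_neg hwu, if_pos ((hqV w).2 hw)] at this
    · exact fun w hw => conn_edges q ((hqV w).2 hw)
  rw [Nat.card_congr (Equiv.ofBijective (fun q => (⟨q.1.edges.toFinset, hmem q⟩ :
    {S // S ∈ g.edges.powerset.filter (IsPathSet g.verts u v)})) ⟨?_, ?_⟩)]
  · rw [Nat.card_eq_fintype_card, Fintype.card_coe]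
  · rintro ⟨q, hq⟩ ⟨q', hq'⟩ h
    rw [Subtype.mk.injEq] at h ⊢
    exact eq_of_edges_eq hq.1 hq'.1 h
  · rintro ⟨S, hS⟩
    rw [Finset.mem_filter, Finset.mem_powerset] at hS
    obtain ⟨hSg, hSu, hSv, hS2, hSc⟩ := hS
    obtain ⟨q, hq, hqS⟩ := exists_path_of_deg (Γ := Γ) (fun e he => (hΓ e).1 (hSg he)) huv hSu hSv
      (fun w hwu hwv => by
        by_cases hw : w ∈ g.verts
        · exact .inr (hS2 w hw hwu hwv)
        · exact .inl (deg_eq_zero g hSg hw))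
    have hclosed : ∀ y ∈ q.support, ∀ z, s(y, z) ∈ S → s(y, z) ∈ q.edges.toFinset := by
      intro y hy z hyz
      have hle : deg S y ≤ deg q.edges.toFinset y := by
        have h1 := deg_edges_of_isPath hq y
        rw [if_pos hy] at h1
        by_cases hyu : y = u
        · subst hyu
          rw [if_pos rfl, if_neg huv] at h1
          omega
        · by_cases hyv : y = v
          · subst hyv
            rw [if_pos rfl, if_neg hyu] at h1
            omega
          · rw [if_neg hyu, if_neg hyv] at h1
            have := hS2 y (g.mem_verts _ (hSg hyz) y (by simp)) hyu hyv
            omega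
      have := Finset.eq_of_subset_of_card_le
        (Finset.filter_subset_filter (fun e => y ∈ e) hqS) hle
      have h2 : s(y, z) ∈ S.filter (y ∈ ·) := by simp [hyz]
      rw [← this] at h2
      exact (Finset.mem_filter.1 h2).1
    have hsupp : ∀ w, Conn S u w → w ∈ q.support := by
      intro w hw
      induction hw with
      | refl => exact q.start_mem_support
      | @tail y z _ hyz ih =>
        exact q.snd_mem_support_of_mem_edges (List.mem_toFinset.1 (hclosed y ih z hyz))
    refine ⟨⟨q, hq, fun x => ⟨fun hx => ?_, fun hx => hsupp x (hSc x hx)⟩⟩, ?_⟩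
    · by_contra hxV
      have h1 := deg_edges_of_isPath hq x
      have h2 := deg_mono hqS x
      rw [deg_eq_zero g hSg hxV] at h2
      rw [if_pos hx, if_neg (fun h : x = u => hxV (h ▸ hu)),
        if_neg (fun h : x = v => hxV (h ▸ hv))] at h1
      omega
    · refine Subtype.ext (Finset.Subset.antisymm hqS fun e he => ?_)
      induction e with
      | h y z =>
        exact hclosed y (hsupp y (hSc y (g.mem_verts _ (hSg he) y (by simp)))) z he

/-- the boundary state of a Hamiltonian path between the first two corners -/
def cornerPathState : BState := ⟨1, 1, 2, true, true, true, false, false, false⟩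

/-- the boundary state of a Hamiltonian path between the first corner and a marked vertex -/
def markedPathState : BState := ⟨1, 2, 2, true, true, true, true, true, true⟩

theorem corner_cases (g : Gadget α) {v : α} (hv : v ∈ Set.range g.corner) :
    v = g.corner 0 ∨ v = g.corner 1 ∨ v = g.corner 2 := by
  obtain ⟨i, rfl⟩ := hv
  fin_cases i <;> simp

theorem count_cornerPathState (g : Gadget α) : count g ∅ cornerPathState =
    (g.edges.powerset.filter (IsPathSet g.verts (g.corner 0) (g.corner 1))).card := by
  have h02 := g.corner_injective.ne (a₁ := 0) (a₂ := 2) (by decide)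
  have h12 := g.corner_injective.ne (a₁ := 1) (a₂ := 2) (by decide)
  have hm : ∀ S v, ¬ Marked g ∅ S v := by
    rintro S v ⟨x, -, -, hx, -⟩
    exact hx
  rw [count]
  congr 1
  refine Finset.filter_congr fun S hS => ?_
  rw [Finset.mem_powerset] at hS
  simp only [state, cornerPathState, BState.mk.injEq, decide_eq_true_eq, decide_eq_false_iff_not,
    hm, not_false_eq_true, and_true]
  constructor
  · rintro ⟨hC, h0, h1, h2, hc1, hc2, -⟩
    refine ⟨h0, h1, fun w hw hw0 hw1 => ?_, fun w hw => ?_⟩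
    · by_cases hwc : w ∈ Set.range g.corner
      · rcases corner_cases g hwc with rfl | rfl | rfl
        exacts [absurd rfl hw0, absurd rfl hw1, h2]
      · rw [hC.2.2.1 w hw hwc, if_neg (Set.notMem_empty _)]
    · obtain ⟨v, hv, hvd, hvc⟩ := hC.2.2.2 w hw
      refine Conn.trans ?_ hvc.symm
      by_cases hvr : v ∈ Set.range g.corner
      · rcases corner_cases g hvr with rfl | rfl | rfl
        exacts [.refl, hc1, hc2]
      · have := hC.2.2.1 v hv hvr
        rw [if_neg (Set.notMem_empty _)] at this
        omega
  · rintro ⟨h0, h1, h2, hc⟩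
    have hd2 := h2 _ (g.corner_mem 2) h02.symm h12.symm
    have hc1 := hc _ (g.corner_mem 1)
    have hc2 := hc _ (g.corner_mem 2)
    refine ⟨⟨hS, fun i => ?_, fun w hw hwc => ?_, fun w hw => ?_⟩, h0, h1, hd2, hc1, hc2,
      hc1.symm.trans hc2⟩
    · fin_cases i
      exacts [h0.le.trans one_le_two, h1.le.trans one_le_two, hd2.le]
    · rw [if_neg (Set.notMem_empty _)]
      exact h2 w hw (fun h => hwc ⟨0, h.symm⟩) fun h => hwc ⟨1, h.symm⟩
    · exact ⟨_, g.corner_mem 0, h0.le, (hc w hw).symm⟩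

theorem count_markedPathState (g : Gadget α) {x : α} (hx : x ∈ g.verts)
    (hxc : x ∉ Set.range g.corner) : count g {x} markedPathState =
      (g.edges.powerset.filter (IsPathSet g.verts (g.corner 0) x)).card := by
  have h01 := g.corner_injective.ne (a₁ := 0) (a₂ := 1) (by decide)
  have h02 := g.corner_injective.ne (a₁ := 0) (a₂ := 2) (by decide)
  have hne : ∀ i, g.corner i ≠ x := fun i h => hxc ⟨i, h⟩
  have hm : ∀ S v, Marked g {x} S v ↔ Conn S v x := by
    intro S v
    refine ⟨?_, fun hc => ⟨x, hx, hxc, rfl, hc⟩⟩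
    rintro ⟨y, -, -, rfl, hc⟩
    exact hc
  rw [count]
  congr 1
  refine Finset.filter_congr fun S hS => ?_
  rw [Finset.mem_powerset] at hS
  simp only [state, markedPathState, BState.mk.injEq, decide_eq_true_eq, hm]
  constructor
  · rintro ⟨hC, h0, h1, h2, hc1, hc2, -, hcx, -⟩
    refine ⟨h0, ?_, fun w hw hw0 hwx => ?_, fun w hw => ?_⟩
    · rw [hC.2.2.1 x hx hxc, if_pos (Set.mem_singleton x)]
    · by_cases hwc : w ∈ Set.range g.corner
      · rcases corner_cases g hwc with rfl | rfl | rfl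
        exacts [absurd rfl hw0, h1, h2]
      · rw [hC.2.2.1 w hw hwc, if_neg (Set.mem_singleton_iff.not.2 hwx)]
    · obtain ⟨v, hv, hvd, hvc⟩ := hC.2.2.2 w hw
      refine Conn.trans ?_ hvc.symm
      by_cases hvr : v ∈ Set.range g.corner
      · rcases corner_cases g hvr with rfl | rfl | rfl
        exacts [.refl, hc1, hc2]
      · have := hC.2.2.1 v hv hvr
        by_cases hvx : v = x
        · exact hvx ▸ hcx
        · rw [if_neg (Set.mem_singleton_iff.not.2 hvx)] at this
          omega
  · rintro ⟨h0, hx1, h2, hc⟩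
    have hd1 := h2 _ (g.corner_mem 1) h01.symm (hne 1)
    have hd2 := h2 _ (g.corner_mem 2) h02.symm (hne 2)
    have hc1 := hc _ (g.corner_mem 1)
    have hc2 := hc _ (g.corner_mem 2)
    have hcx := hc _ hx
    refine ⟨⟨hS, fun i => ?_, fun w hw hwc => ?_, fun w hw => ?_⟩, h0, hd1, hd2, hc1, hc2,
      hc1.symm.trans hc2, hcx, hc1.symm.trans hcx, hc2.symm.trans hcx⟩
    · fin_cases i
      exacts [h0.le.trans one_le_two, hd1.le, hd2.le]
    · by_cases hwx : w = x
      · rw [hwx, hx1, if_pos (Set.mem_singleton x)]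
      · rw [if_neg (Set.mem_singleton_iff.not.2 hwx)]
        exact h2 w hw (fun h => hwc ⟨0, h.symm⟩) hwx
    · exact ⟨_, g.corner_mem 0, h0.le, (hc w hw).symm⟩

end HamiltonianPath

theorem mem_edgeSet_gasket (n : ℕ) (e : Sym2 (ℝ × ℝ)) :
    e ∈ (gasket n).edges ↔ e ∈ (G n).edgeSet := by
  rw [G, SimpleGraph.edgeSet_fromEdgeSet, gasket, Set.Finite.mem_toFinset, Set.mem_sdiff]
  exact ⟨fun he => ⟨he, not_isDiag_of_mem_E n e he⟩, fun he => he.1⟩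

theorem f1_eq_count (n : ℕ) : f1 n = count (gasket n) ∅ cornerPathState := by
  rw [count_cornerPathState]
  exact card_path_eq (gasket n) (mem_edgeSet_gasket n) (outer_mem n 0) (outer_mem n 1)
    ((outer_injective n).ne (a₁ := 0) (a₂ := 1) (by decide))

theorem f_eq_count {n : ℕ} {x : ℝ × ℝ} (hx : x ∈ V n) (hxc : x ∉ Set.range (outer n)) :
    f n o x = count (gasket n) {x} markedPathState := by
  rw [count_markedPathState (gasket n) hx hxc]
  exact card_path_eq (gasket n) (mem_edgeSet_gasket n) (outer_mem n 0) hx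
    fun h => hxc ⟨0, h⟩

/-! ### The weights of the gasket -/

/-- the weights of `SG n` for `1 ≤ n`, up to a factor -/
def gasketWeights : Weights :=
  [(triangleState true true false, 2), (triangleState true false true, 2),
    (triangleState false true true, 2), (triangleState true false false, 3),
    (triangleState false true false, 3), (triangleState false false true, 3)]

/-- the factor by which the weights of `SG (n + 1)` exceed `gasketWeights` -/
def scale : ℕ → ℕ
  | 0 => 1
  | n + 1 => 12 * scale n ^ 3

theorem scale_pos (n : ℕ) : 0 < scale n := by
  induction n with
  | zero => exact one_pos
  | succ n ih => exact mul_pos (by norm_num) (pow_pos ih 3)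

theorem equal_triangleWeights :
    Weights.equal 1 (glueWeights (atNode none) fun _ => triangleWeights) gasketWeights = true := by
  decide +kernel

theorem equal_gasketWeights :
    Weights.equal 12 (glueWeights (atNode none) fun _ => gasketWeights) gasketWeights = true := by
  decide +kernel

theorem count_gasket (n : ℕ) (σ : BState) :
    count (gasket (n + 1)) ∅ σ = scale n * gasketWeights.val σ := by
  induction n generalizing σ with
  | zero =>
    rw [count_gasket_succ (k := 1) (fun σ => by rw [count_gasket_zero, one_mul]),
      Weights.val_eq_of_equal equal_triangleWeights, scale, one_pow, one_mul]
  | succ n ih =>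
    rw [count_gasket_succ ih, Weights.val_eq_of_equal equal_gasketWeights, scale]
    ring

theorem f1_succ (n : ℕ) : f1 (n + 1) = scale n * 2 := by
  rw [f1_eq_count, count_gasket]
  congr 1

/-- the weights of `SG (n + 1)` with a marked vertex in the `i`-th copy of `SG n` -/
def nextWeights (i : Fin 3) (D : Weights) : Weights :=
  glueWeights (atNode none) fun j => bif decide (j = i) then D else gasketWeights

theorem val_nextWeights_zero (D : Weights) (τ : BState) :
    (nextWeights 0 D).val τ = (D.map fun x => x.2 * (nextWeights 0 [(x.1, 1)]).val τ).sum := by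
  simp only [nextWeights, val_glueWeights, ← List.sum_map_mul_left]
  simp [mul_assoc]

/-- the state of a path from a corner of degree one to a marked vertex -/
def endState (d0 d1 d2 : ℕ) : BState :=
  ⟨d0, d1, d2, Nat.blt 0 d0 && Nat.blt 0 d1, Nat.blt 0 d0 && Nat.blt 0 d2,
    Nat.blt 0 d1 && Nat.blt 0 d2, Nat.blt 0 d0, Nat.blt 0 d1, Nat.blt 0 d2⟩

/-- the state of two paths, one of which joins the second corner to a marked vertex -/
def splitState₁ : BState := ⟨1, 1, 1, false, true, false, false, true, false⟩

/-- the state of two paths, one of which joins the third corner to a marked vertex -/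
def splitState₂ : BState := ⟨1, 1, 1, true, false, false, false, false, true⟩

/-- the states with a marked vertex which do not contribute to `markedPathState` at the
next level -/
def idleStates : List BState :=
  ⟨1, 1, 1, false, false, true, true, false, false⟩ ::
    [0, 2].flatMap fun x => [0, 2].flatMap fun y => [endState 1 x y, endState x 1 y, endState x y 1]

/-- the states which occur with a marked vertex -/
def markedStates : List BState := splitState₁ :: splitState₂ :: idleStates

theorem markedStates_nodup : markedStates.Nodup := by decide +kernel

theorem nextWeights_support : ∀ σ ∈ markedStates, ∀ e ∈ nextWeights 0 [(σ, 1)],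
    e.1 ∈ markedStates := by
  decide +kernel

theorem nextWeights_idle : ∀ σ ∈ idleStates,
    (nextWeights 0 [(σ, 1)]).val markedPathState = 0 ∧
    (nextWeights 0 [(σ, 1)]).val splitState₁ + (nextWeights 0 [(σ, 1)]).val splitState₂ = 0 := by
  decide +kernel

theorem nextWeights_split : ∀ σ ∈ [splitState₁, splitState₂],
    (nextWeights 0 [(σ, 1)]).val markedPathState = 4 ∧
    (nextWeights 0 [(σ, 1)]).val splitState₁ + (nextWeights 0 [(σ, 1)]).val splitState₂ = 12 := by
  decide +kernel

theorem Weights.val_map {L : List BState} (hL : L.Nodup) (φ : BState → ℕ) (σ : BState) :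
    Weights.val (L.map fun τ => (τ, φ τ)) σ = if σ ∈ L then φ σ else 0 := by
  induction L with
  | nil => simp [val_nil]
  | cons τ L ih =>
    rw [List.nodup_cons] at hL
    rw [List.map_cons, val_cons, ih hL.2]
    by_cases hτ : τ = σ
    · subst hτ
      simp [hL.1]
    · simp [hτ, Ne.symm hτ]

theorem outer_zero_add (n : ℕ) (x : ℝ × ℝ) : outer n 0 + x = x := zero_add x

theorem count_gasket_next {n : ℕ} {x : ℝ × ℝ} (hx : x ∈ V (n + 1))
    (hxc : x ∉ Set.range (outer (n + 1)))
    (hs : ∀ σ ∉ markedStates, count (gasket (n + 1)) {x} σ = 0) (τ : BState) :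
    count (gasket (n + 2)) {x} τ = scale n ^ 2 * (markedStates.map fun σ =>
      count (gasket (n + 1)) {x} σ * (nextWeights 0 [(σ, 1)]).val τ).sum := by
  have H := count_gasket_piece (count_gasket n) hx hxc (k' := 1)
    (D' := markedStates.map fun σ => (σ, count (gasket (n + 1)) {x} σ)) (fun σ => by
      rw [Weights.val_map markedStates_nodup, one_mul]
      split
      · rfl
      · next h => exact hs σ h) 0 τ
  rw [outer_zero_add, one_mul] at H
  rw [H, ← nextWeights, val_nextWeights_zero, List.map_map]
  rfl

/-- the number of forests which consist of two paths, one of which joins a corner to `x` -/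
def splitCount (n : ℕ) (x : ℝ × ℝ) : ℕ :=
  count (gasket n) {x} splitState₁ + count (gasket n) {x} splitState₂

theorem sum_markedStates {φ ψ : BState → ℕ} {r : ℕ} (h₀ : ∀ σ ∈ idleStates, ψ σ = 0)
    (h₁ : ∀ σ ∈ [splitState₁, splitState₂], ψ σ = r) :
    (markedStates.map fun σ => φ σ * ψ σ).sum = r * (φ splitState₁ + φ splitState₂) := by
  have h : (idleStates.map fun σ => φ σ * ψ σ).sum = 0 :=
    List.sum_eq_zero fun y hy => by
      obtain ⟨σ, hσ, rfl⟩ := List.mem_map.1 hy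
      rw [h₀ σ hσ, mul_zero]
  rw [markedStates, List.map_cons, List.map_cons, List.sum_cons, List.sum_cons, h,
    h₁ _ (by simp), h₁ _ (by simp)]
  ring

section Next

variable {n : ℕ} {x : ℝ × ℝ} (hx : x ∈ V (n + 1)) (hxc : x ∉ Set.range (outer (n + 1)))
  (hs : ∀ σ ∉ markedStates, count (gasket (n + 1)) {x} σ = 0)
include hx hxc hs

theorem count_gasket_next_eq_zero {τ : BState} (hτ : τ ∉ markedStates) :
    count (gasket (n + 2)) {x} τ = 0 := by
  rw [count_gasket_next hx hxc hs, List.sum_eq_zero, mul_zero]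
  intro y hy
  obtain ⟨σ, hσ, rfl⟩ := List.mem_map.1 hy
  rw [Weights.val_eq_zero, mul_zero]
  intro h
  obtain ⟨e, he, rfl⟩ := List.mem_map.1 h
  exact hτ (nextWeights_support σ hσ e he)

theorem count_gasket_next_markedPathState :
    count (gasket (n + 2)) {x} markedPathState = scale n ^ 2 * (4 * splitCount (n + 1) x) := by
  rw [count_gasket_next hx hxc hs, sum_markedStates (fun σ hσ => (nextWeights_idle σ hσ).1)
    fun σ hσ => (nextWeights_split σ hσ).1, splitCount]

theorem splitCount_next : splitCount (n + 2) x = scale n ^ 2 * (12 * splitCount (n + 1) x) := by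
  rw [splitCount, count_gasket_next hx hxc hs, count_gasket_next hx hxc hs, ← mul_add,
    ← List.sum_map_add]
  simp only [← mul_add]
  rw [sum_markedStates (fun σ hσ => (nextWeights_idle σ hσ).2)
    fun σ hσ => (nextWeights_split σ hσ).2, splitCount]

theorem F_next : F (n + 2) x = splitCount (n + 1) x / (6 * scale n) := by
  have hx' : x ∈ V (n + 2) := outer_zero_add (n + 1) x ▸ mem_V_succ_of_mem (i := 0) hx
  have hxc' : x ∉ Set.range (outer (n + 2)) :=
    outer_zero_add (n + 1) x ▸ not_mem_range_outer_succ (i := 0) hx hxc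
  have hpos : (scale n : ℝ) ≠ 0 := Nat.cast_ne_zero.2 (scale_pos n).ne'
  rw [F, f_eq_count hx' hxc', count_gasket_next_markedPathState hx hxc hs, f1_succ, scale]
  push_cast
  field_simp
  ring

theorem F_of_le {N : ℕ} (hN : n + 2 ≤ N) : F N x = splitCount (n + 1) x / (6 * scale n) := by
  obtain ⟨l, rfl⟩ := Nat.exists_eq_add_of_le hN
  clear hN
  induction l generalizing n with
  | zero => exact F_next hx hxc hs
  | succ l ih =>
    have hpos : (scale n : ℝ) ≠ 0 := Nat.cast_ne_zero.2 (scale_pos n).ne'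
    have h := ih (n := n + 1) (outer_zero_add (n + 1) x ▸ mem_V_succ_of_mem (i := 0) hx)
      (outer_zero_add (n + 1) x ▸ not_mem_range_outer_succ (i := 0) hx hxc)
      fun τ hτ => count_gasket_next_eq_zero hx hxc hs hτ
    rw [show n + 2 + (l + 1) = n + 1 + 2 + l by ring, h, splitCount_next hx hxc hs, scale]
    push_cast
    field_simp

end Next

/-! ### The mid-side vertices -/

/-- the weights of `SG (m + 2)` with a marked junction in the `i`-th copy of `SG (m + 1)` in terms
of the weights of `SG m` -/
def markedWeights (D : Weights) (i : Fin 3) (s : Fin 6) : Weights :=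
  nextWeights i (glueWeights (atNode (some s)) fun _ => D)

/-- the data of `markedWeights` that determine the distribution ratio -/
abbrev MarkedValues (D : Weights) (i : Fin 3) (s : Fin 6) (v w : ℕ) : Prop :=
  (∀ e ∈ markedWeights D i s, e.1 ∈ markedStates) ∧
  (markedWeights D i s).val markedPathState = v ∧
  (markedWeights D i s).val splitState₁ + (markedWeights D i s).val splitState₂ = w

/-- the vertex of `SG (m + 2)` that is the junction of the copies `s` and `t` of `SG m` in the
`i`-th copy of `SG (m + 1)` -/
def midside (m : ℕ) (i s t : Fin 3) : ℝ × ℝ := outer (m + 1) i + (outer m s + outer m t)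

theorem F_of_markedValues {m k q : ℕ} {D : Weights}
    (hD : ∀ σ, count (gasket m) ∅ σ = k * D.val σ) (hk : scale m = q * k ^ 3) {i s t : Fin 3}
    (hst : s ≠ t) {v w : ℕ} (h : MarkedValues D i (node s t) v w) :
    F (m + 2) (midside m i s t) = v / (24 * q) ∧
      ∀ N, m + 3 ≤ N → F N (midside m i s t) = w / (72 * q) := by
  obtain ⟨h0, hv, hw⟩ := h
  have hy : outer m s + outer m t ∈ V (m + 1) := junction_mem
  have hyc : outer m s + outer m t ∉ Set.range (outer (m + 1)) := junction_not_mem_range_outer hst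
  have hx : midside m i s t ∈ V (m + 2) := mem_V_succ_of_mem hy
  have hxc : midside m i s t ∉ Set.range (outer (m + 2)) := not_mem_range_outer_succ hy hyc
  have hc : ∀ σ, count (gasket (m + 2)) {midside m i s t} σ =
      k ^ 3 * scale m ^ 2 * (markedWeights D i (node s t)).val σ :=
    count_gasket_piece (count_gasket m) hy hyc (count_gasket_junction hD hst) i
  have hq := scale_pos m
  have hk0 : (k : ℝ) ≠ 0 := by
    rintro h
    rw [Nat.cast_eq_zero] at h
    simp [hk, h] at hq
  have hq0 : (q : ℝ) ≠ 0 := by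
    rintro h
    rw [Nat.cast_eq_zero] at h
    simp [hk, h] at hq
  constructor
  · rw [F, f_eq_count hx hxc, hc, hv, f1_succ, scale, hk]
    push_cast
    field_simp
    ring
  · intro N hN
    rw [F_of_le hx hxc _ hN, splitCount, hc, hc, ← mul_add, hw, scale, hk]
    · push_cast
      field_simp
      ring
    · intro σ hσ
      rw [hc, Weights.val_eq_zero, mul_zero]
      intro h
      obtain ⟨e, he, rfl⟩ := List.mem_map.1 h
      exact hσ (h0 e he)

theorem F_midside {x : ℕ → ℝ × ℝ} {i s t : Fin 3} (hx : ∀ m, x (m + 1) = midside m i s t)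
    (hst : s ≠ t) {v w v' w' : ℕ} (h : MarkedValues triangleWeights i (node s t) v w)
    (h' : MarkedValues gasketWeights i (node s t) v' w') :
    (∀ n, 2 ≤ n → F n (x (n - 1)) = if n = 2 then (v : ℝ) / 24 else (v' : ℝ) / 288) ∧
      ∀ n m, 1 ≤ m → m ≤ n - 2 → F n (x m) = if m = 1 then (w : ℝ) / 72 else (w' : ℝ) / 864 := by
  have h₀ := F_of_markedValues (m := 0) (k := 1) (q := 1)
    (fun σ => by rw [count_gasket_zero, one_mul]) rfl hst h
  have h₁ : ∀ m, _ := fun m => F_of_markedValues (count_gasket m) (q := 12) rfl hst h'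
  norm_num at h₀ h₁
  constructor
  · intro n hn
    obtain ⟨m, rfl⟩ := Nat.exists_eq_add_of_le' hn
    rw [Nat.add_sub_assoc (by norm_num), hx]
    cases m with
    | zero => exact h₀.1
    | succ m => rw [if_neg (by omega)]; exact (h₁ m).1
  · intro n m hm hmn
    obtain ⟨m, rfl⟩ := Nat.exists_eq_add_of_le' hm
    rw [hx]
    cases m with
    | zero => exact h₀.2 n (by omega)
    | succ m => rw [if_neg (by omega)]; exact (h₁ m).2 n (by omega)

section Coordinates

variable (m : ℕ)

theorem a1_succ : a1 (m + 1) = midside m 1 0 1 := by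
  simp only [a1, midside, outer, o, a, pow_succ, Prod.mk_add_mk, Prod.mk.injEq]
  constructor <;> ring

theorem b1_succ : b1 (m + 1) = midside m 1 0 2 := by
  simp only [b1, midside, outer, o, a, b, pow_succ, Prod.mk_add_mk, Prod.mk.injEq]
  constructor <;> ring

theorem c1_succ : c1 (m + 1) = midside m 1 1 2 := by
  simp only [c1, midside, outer, a, b, pow_succ, Prod.mk_add_mk, Prod.mk.injEq]
  constructor <;> ring

theorem a2_succ : a2 (m + 1) = midside m 2 0 1 := by
  simp only [a2, midside, outer, o, a, b, pow_succ, Prod.mk_add_mk, Prod.mk.injEq]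
  constructor <;> ring

theorem b2_succ : b2 (m + 1) = midside m 2 0 2 := by
  simp only [b2, midside, outer, o, b, pow_succ, Prod.mk_add_mk, Prod.mk.injEq]
  constructor <;> ring

theorem c2_succ : c2 (m + 1) = midside m 2 1 2 := by
  simp only [c2, midside, outer, a, b, pow_succ, Prod.mk_add_mk, Prod.mk.injEq]
  constructor <;> ring

end Coordinates


/-- the distribution ratio at the mid-side vertices. -/
theorem F_midside_vertices : ∀ n : ℕ, 2 ≤ n →
    (F n (a2 (n - 1)) = (if n = 2 then 5 / 12 else 1 / 2) ∧
     F n (c2 (n - 1)) = (if n = 2 then 5 / 12 else 1 / 2) ∧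
     F n (b1 (n - 1)) = (if n = 2 then 5 / 12 else 1 / 2) ∧
     F n (c1 (n - 1)) = (if n = 2 then 5 / 12 else 1 / 2) ∧
     F n (b2 (n - 1)) = (if n = 2 then 1 / 6 else 0) ∧
     F n (a1 (n - 1)) = (if n = 2 then 1 / 6 else 0)) ∧
    (∀ m : ℕ, 1 ≤ m → m ≤ n - 2 →
      F n (a2 m) = (if m = 1 then 11 / 18 else 1 / 2) ∧
      F n (b1 m) = (if m = 1 then 11 / 18 else 1 / 2) ∧
      F n (b2 m) = (if m = 1 then 49 / 72 else 1) ∧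
      F n (a1 m) = (if m = 1 then 49 / 72 else 1) ∧
      F n (c2 m) = (if m = 1 then 73 / 72 else 3 / 2) ∧
      F n (c1 m) = (if m = 1 then 73 / 72 else 3 / 2)) := by
  have ha1 := F_midside a1_succ (by decide) (v := 4) (w := 49) (v' := 0) (w' := 864)
    (by decide +kernel) (by decide +kernel)
  have hb1 := F_midside b1_succ (by decide) (v := 10) (w := 44) (v' := 144) (w' := 432)
    (by decide +kernel) (by decide +kernel)
  have hc1 := F_midside c1_succ (by decide) (v := 10) (w := 73) (v' := 144) (w' := 1296)
    (by decide +kernel) (by decide +kernel)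
  have ha2 := F_midside a2_succ (by decide) (v := 10) (w := 44) (v' := 144) (w' := 432)
    (by decide +kernel) (by decide +kernel)
  have hb2 := F_midside b2_succ (by decide) (v := 4) (w := 49) (v' := 0) (w' := 864)
    (by decide +kernel) (by decide +kernel)
  have hc2 := F_midside c2_succ (by decide) (v := 10) (w := 73) (v' := 144) (w' := 1296)
    (by decide +kernel) (by decide +kernel)
  norm_num at ha1 hb1 hc1 ha2 hb2 hc2
  intro n hn
  exact ⟨⟨ha2.1 n hn, hc2.1 n hn, hb1.1 n hn, hc1.1 n hn, hb2.1 n hn, ha1.1 n hn⟩,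
    fun m hm hmn => ⟨ha2.2 n m hm hmn, hb1.2 n m hm hmn, hb2.2 n m hm hmn, ha1.2 n m hm hmn,
      hc2.2 n m hm hmn, hc1.2 n m hm hmn⟩⟩

end SierpinskiGasket
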